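/- arXiv:2107.04066 — 6 statements merged into one kernel-verified Lean document; each statement's English description precedes it below -/
import Mathlib

section
/- Let D be a finite directed multigraph and D' a subgraph of D. Let α be an edge weighting of D' that is positive on every directed cycle of D', and let (α_i)_{i∈ℕ} be a sequence of edge weightings of D, each positive on every directed cycle of D, such that: (1) α_i(γ) = α(γ) for every directed cycle γ contained in D' and every i; (2) α_i(γ) → ∞ as i → ∞ for every directed cycle γ of D not contained in D'; and (3) liminf_{i→∞} gr_D(α_i) > 1. Then gr_D(α_i) ≥ gr_{D'}(α) for every i, and gr_D(α_i) → gr_{D'}(α) as i → ∞. -/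
/-- A finite directed multigraph on vertex type `V` and edge type `E`:
each edge has a source and a target vertex (loops and parallel edges allowed). -/
structure Multidigraph (V E : Type) where
  src : E → V
  tgt : E → V

namespace Multidigraph

variable {V E : Type} (D : Multidigraph V E)

/-- A cycle word: a nonempty list of edges that is cyclically composable. -/
def IsCycleWord (l : List E) : Prop :=
  l ≠ [] ∧ ∀ i j : Fin l.length, ((i : ℕ) + 1) % l.length = (j : ℕ) →
    D.tgt (l.get i) = D.src (l.get j)

/-- Cycle words up to cyclic rotation. -/
def cycleSetoid : Setoid { l : List E // D.IsCycleWord l } where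
  r a b := List.IsRotated a.1 b.1
  iseqv := ⟨fun a => List.IsRotated.refl a.1, fun h => h.symm, fun h h' => h.trans h'⟩

/-- A directed cycle of `D`: a cycle word considered up to cyclic rotation. -/
def Cycle := Quotient D.cycleSetoid

/-- The value of an edge weighting on a directed cycle: the sum of the weights
of the edges it traverses. -/
noncomputable def weight (α : E → ℝ) (c : D.Cycle) : ℝ :=
  Quotient.lift (fun l : { l : List E // D.IsCycleWord l } => (l.1.map α).sum)
    (fun a b h => by
      have h' : List.IsRotated a.1 b.1 := h
      exact List.Perm.sum_eq (List.Perm.map α (List.IsRotated.perm h'))) c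

/-- An edge lies on a directed cycle. -/
def EdgeMem (e : E) (c : D.Cycle) : Prop :=
  ∃ l : { l : List E // D.IsCycleWord l }, Quotient.mk D.cycleSetoid l = c ∧ e ∈ l.1

/-- A directed cycle is contained in the subgraph with edge set `E'`. -/
def CycleIn (E' : Set E) (c : D.Cycle) : Prop :=
  ∀ e : E, D.EdgeMem e c → e ∈ E'

/-- The growth rate of the directed cycles contained in the subgraph with edge set `E'`,
counted with respect to the edge weighting `α`:
`limsup_{L → ∞} (#{cycles γ in the subgraph with α(γ) ≤ L})^(1/L)`. -/
noncomputable def growthRateOn (E' : Set E) (α : E → ℝ) : ℝ :=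
  Filter.limsup
    (fun L : ℝ =>
      (Nat.card { c : D.Cycle | D.CycleIn E' c ∧ D.weight α c ≤ L } : ℝ) ^ (1 / L))
    Filter.atTop

/-- The growth rate of all directed cycles of `D` with respect to `α`. -/
noncomputable def growthRate (α : E → ℝ) : ℝ :=
  D.growthRateOn Set.univ α

end Multidigraph

namespace Multidigraph

variable {V E : Type} (D : Multidigraph V E)

/-- `l` is a directed walk from `v` to `w`. -/
def Walk : V → List E → V → Prop
  | v, [], w => v = w
  | v, e :: l, w => D.src e = v ∧ Walk (D.tgt e) l w

theorem walk_append (v w : V) (a b : List E) :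
    D.Walk v (a ++ b) w ↔ ∃ u, D.Walk v a u ∧ D.Walk u b w := by
  induction a generalizing v with
  | nil => simp [Walk]
  | cons e a ih => simp [Walk, ih, and_assoc]

theorem walk_iff (v w : V) (l : List E) :
    D.Walk v l w ↔ (l = [] ∧ v = w) ∨ (∃ h : 0 < l.length, D.src l[0] = v ∧
      D.tgt (l[l.length - 1]'(by omega)) = w ∧
      ∀ i (hi : i + 1 < l.length), D.tgt l[i] = D.src l[i+1]) := by
  induction l generalizing v with
  | nil => simp [Walk]
  | cons e l ih =>
    simp only [Walk, ih]
    rcases l with _ | ⟨f, l⟩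
    · simp
    · constructor
      · rintro ⟨h1, h | ⟨h, h2, h3, h4⟩⟩
        · simp at h
        · refine Or.inr ⟨by simp, by simpa using h1, by simpa using h3, ?_⟩
          intro i hi
          rcases i with _ | i
          · simpa using h2.symm
          · exact h4 i (by simpa using hi)
      · rintro (h | ⟨h, h2, h3, h4⟩)
        · simp at h
        · refine ⟨by simpa using h2, Or.inr ⟨by simp, ?_, by simpa using h3, ?_⟩⟩
          · simpa using (h4 0 (by simp)).symm
          · intro i hi
            exact h4 (i+1) (by simpa using hi)

theorem isCycleWord_iff (l : List E) :
    D.IsCycleWord l ↔ l ≠ [] ∧ ∃ v, D.Walk v l v := by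
  unfold IsCycleWord
  refine and_congr_right fun hl => ?_
  have hpos : 0 < l.length := List.length_pos_iff.2 hl
  constructor
  · intro h
    refine ⟨D.src l[0], (D.walk_iff _ _ _).2 (Or.inr ⟨hpos, rfl, ?_, ?_⟩)⟩
    · have := h ⟨l.length - 1, by omega⟩ ⟨0, hpos⟩ (by
        simp [Nat.sub_add_cancel hpos])
      simpa using this
    · intro i hi
      have := h ⟨i, by omega⟩ ⟨i+1, hi⟩ (by simp [Nat.mod_eq_of_lt hi])
      simpa using this
  · rintro ⟨v, h⟩ i j hij
    rcases (D.walk_iff _ _ _).1 h with h | ⟨_, h1, h2, h3⟩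
    · exact absurd h.1 hl
    · by_cases hi : (i : ℕ) + 1 < l.length
      · rw [Nat.mod_eq_of_lt hi] at hij
        have := h3 i hi
        simp only [List.get_eq_getElem]
        rw [this]
        congr 2
      · have hi' : (i : ℕ) + 1 = l.length := by omega
        have hj : (j : ℕ) = 0 := by rw [← hij, hi', Nat.mod_self]
        simp only [List.get_eq_getElem]
        have e1 : l[(i:ℕ)] = l[l.length - 1] := by congr 1; omega
        have e2 : l[(j:ℕ)] = l[0] := by congr 1
        rw [e1, e2, h1, h2]

theorem walk_take_drop (v w : V) (l : List E) (h : D.Walk v l w) (i : ℕ) (hi : i < l.length) :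
    D.Walk v (l.take i) (D.src l[i]) ∧ D.Walk (D.src l[i]) (l.drop i) w := by
  have h' := h
  rw [← List.take_append_drop i l, walk_append] at h'
  obtain ⟨u, h1, h2⟩ := h'
  have h3 := h2
  rw [List.drop_eq_getElem_cons hi] at h3
  obtain ⟨h4, _⟩ := h3
  rw [h4]
  exact ⟨h1, h2⟩

/-- Nonnegativity on short closed walks implies nonnegativity on all closed walks. -/
theorem nonneg_of_short [Fintype V] (β : E → ℝ)
    (h : ∀ l v, l.length ≤ Fintype.card V → D.Walk v l v → 0 ≤ (l.map β).sum) :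
    ∀ l v, D.Walk v l v → 0 ≤ (l.map β).sum := by
  intro l
  induction hn : l.length using Nat.strong_induction_on generalizing l with
  | _ n ih =>
    intro v hl
    by_cases hc : l.length ≤ Fintype.card V
    · exact h l v hc hl
    · push Not at hc
      obtain ⟨i, j, hij, heq⟩ := Fintype.exists_ne_map_eq_of_card_lt
        (fun i : Fin l.length => D.src l[i]) (by simpa using hc)
      wlog hlt : i < j generalizing i j
      · exact this j i hij.symm heq.symm (lt_of_le_of_ne (not_lt.1 hlt) hij.symm)
      have hlt' : (i : ℕ) < j := hlt
      have hj := j.2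
      obtain ⟨a1, a2⟩ := D.walk_take_drop v v l hl j hj
      have hi2 : (i : ℕ) < (l.take j).length := by simp; omega
      obtain ⟨b1, b2⟩ := D.walk_take_drop _ _ _ a1 i hi2
      simp only [List.getElem_take] at b1 b2
      simp only [Fin.getElem_fin] at heq
      rw [← heq] at a2 b2
      have c1 := ih ((l.take j).drop i).length (by simp; omega) _ rfl _ b2
      have c2 := ih ((l.take j).take i ++ l.drop j).length (by simp; omega) _ rfl v
        ((D.walk_append _ _ _ _).2 ⟨_, b1, a2⟩)
      have : l = (l.take j).take i ++ (l.take j).drop i ++ l.drop j := by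
        rw [List.take_append_drop, List.take_append_drop]
      rw [this]
      simp only [List.map_append, List.sum_append] at c1 c2 ⊢
      linarith

theorem le_of_short [Fintype V] (β ν : E → ℝ)
    (h : ∀ l v, l.length ≤ Fintype.card V → D.Walk v l v → (l.map ν).sum ≤ (l.map β).sum) :
    ∀ l v, D.Walk v l v → (l.map ν).sum ≤ (l.map β).sum := by
  have key : ∀ l : List E, (l.map (fun e => β e - ν e)).sum = (l.map β).sum - (l.map ν).sum := by
    intro l
    induction l with
    | nil => simp
    | cons a l ih => simp only [List.map_cons, List.sum_cons, ih]; ring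
  intro l v hl
  have := D.nonneg_of_short (fun e => β e - ν e) (fun l v h1 h2 => by
    rw [key]; linarith [h l v h1 h2]) l v hl
  rw [key] at this
  linarith

theorem finite_short [Fintype E] (n : ℕ) : {l : List E | l.length ≤ n}.Finite :=
  List.finite_length_le E n

theorem walk_return (S : Set E)
    (hS : ∀ e ∈ S, ∃ l v, D.Walk v l v ∧ e ∈ l ∧ ∀ f ∈ l, f ∈ S)
    (p : List E) (u v : V) (hp : D.Walk u p v) (hpS : ∀ e ∈ p, e ∈ S) :
    ∃ q, D.Walk v q u ∧ ∀ e ∈ q, e ∈ S := by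
  induction p generalizing u with
  | nil => exact ⟨[], by simpa [Walk] using hp.symm, by simp⟩
  | cons e p ih =>
    obtain ⟨h1, h2⟩ := hp
    obtain ⟨q, hq, hqS⟩ := ih _ h2 (fun f hf => hpS f (by simp [hf]))
    obtain ⟨l, w, hl, hel, hlS⟩ := hS e (hpS e (by simp))
    obtain ⟨a, b, rfl⟩ := List.append_of_mem hel
    obtain ⟨x, hx1, hx2, hx3⟩ := (D.walk_append _ _ _ _).1 hl
    refine ⟨q ++ (b ++ a), ?_, ?_⟩
    · rw [walk_append]
      refine ⟨_, hq, ?_⟩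
      rw [walk_append]
      refine ⟨_, hx3, ?_⟩
      rw [← h1, hx2]; exact hx1
    · intro f hf
      simp only [List.mem_append] at hf
      rcases hf with hf | hf | hf
      · exact hqS f hf
      · exact hlS f (by simp [hf])
      · exact hlS f (by simp [hf])

theorem edgeMem_mk (e : E) (l : { l : List E // D.IsCycleWord l }) :
    D.EdgeMem e (Quotient.mk D.cycleSetoid l) ↔ e ∈ l.1 := by
  constructor
  · rintro ⟨l', h, he⟩
    have : List.IsRotated l'.1 l.1 := Quotient.exact h
    exact this.mem_iff.1 he
  · intro h
    exact ⟨l, rfl, h⟩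

theorem cycleIn_mk (S : Set E) (l : { l : List E // D.IsCycleWord l }) :
    D.CycleIn S (Quotient.mk D.cycleSetoid l) ↔ ∀ e ∈ l.1, e ∈ S := by
  simp only [CycleIn, edgeMem_mk]

theorem weight_mk (β : E → ℝ) (l : { l : List E // D.IsCycleWord l }) :
    D.weight β (Quotient.mk D.cycleSetoid l) = (l.1.map β).sum := rfl

end Multidigraph

namespace Multidigraph

variable {V E : Type} (D : Multidigraph V E)

open Classical in
/-- multiplicative weight of a walk starting at `v` (zero if the list is not a walk) -/
noncomputable def wt (x : E → ENNReal) : V → List E → ENNReal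
  | _, [] => 1
  | v, e :: l => if D.src e = v then x e * wt x (D.tgt e) l else 0

/-- generating function of the walks starting at `v` -/
noncomputable def genF (x : E → ENNReal) (v : V) : ENNReal := ∑' l, D.wt x v l

open Classical in
/-- truncated generating function -/
noncomputable def genT (x : E → ENNReal) (n : ℕ) (v : V) : ENNReal :=
  ∑' l : List E, if l.length < n then D.wt x v l else 0

/-- lists are empty or a cons -/
def listEquiv (E : Type) : Unit ⊕ (E × List E) ≃ List E where
  toFun := Sum.elim (fun _ => []) (fun p => p.1 :: p.2)
  invFun := fun l => match l with
    | [] => Sum.inl ()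
    | e :: l => Sum.inr (e, l)
  left_inv := by rintro (_ | _) <;> rfl
  right_inv := by rintro (_ | _) <;> rfl

theorem tsum_list [Fintype E] (F : List E → ENNReal) :
    ∑' l, F l = F [] + ∑ e, ∑' l, F (e :: l) := by
  rw [← (listEquiv E).tsum_eq, Summable.tsum_sum ENNReal.summable ENNReal.summable]
  congr 1
  · rw [tsum_fintype]; simp [listEquiv]
  · simp only [listEquiv, Equiv.coe_fn_mk, Sum.elim_inr]
    rw [ENNReal.tsum_prod (f := fun e l => F (e :: l)), tsum_fintype]

open Classical in
theorem genF_eq [Fintype E] (x : E → ENNReal) (v : V) :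
    D.genF x v = 1 + ∑ e, if D.src e = v then x e * D.genF x (D.tgt e) else 0 := by
  rw [genF, tsum_list]
  congr 1
  refine Finset.sum_congr rfl fun e _ => ?_
  split_ifs with h
  · simp only [wt, h, if_true, genF, ENNReal.tsum_mul_left]
  · simp [wt, h]

open Classical in
theorem genT_succ [Fintype E] (x : E → ENNReal) (n : ℕ) (v : V) :
    D.genT x (n+1) v = 1 + ∑ e, if D.src e = v then x e * D.genT x n (D.tgt e) else 0 := by
  rw [genT, tsum_list]
  congr 1
  refine Finset.sum_congr rfl fun e _ => ?_
  split_ifs with h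
  · simp only [wt, h, if_true, genT, ← ENNReal.tsum_mul_left, List.length_cons,
      add_lt_add_iff_right, mul_ite, mul_zero]
  · simp [wt, h]

open Classical in
theorem genF_le [Fintype E] (x : E → ENNReal) (g : V → ENNReal)
    (hg : ∀ v, 1 + ∑ e, (if D.src e = v then x e * g (D.tgt e) else 0) ≤ g v) (v : V) :
    D.genF x v ≤ g v := by
  have hT : ∀ n v, D.genT x n v ≤ g v := by
    intro n
    induction n with
    | zero => intro v; simp [genT]
    | succ n ih =>
      intro v
      rw [genT_succ]
      refine le_trans ?_ (hg v)
      gcongr with e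
      split_ifs
      · gcongr; exact ih _
      · exact le_rfl
  rw [genF, ENNReal.tsum_eq_iSup_sum]
  refine iSup_le fun s => ?_
  refine le_trans ?_ (hT (s.sup List.length + 1) v)
  rw [genT]
  refine le_trans (Finset.sum_le_sum fun l hl => ?_) (ENNReal.sum_le_tsum s)
  rw [if_pos (Nat.lt_succ_of_le (Finset.le_sup (f := List.length) hl))]

theorem wt_eq (b : ℝ) (hb : 0 < b) (x : E → ENNReal) (ν : E → ℝ) (l : List E) (v w : V)
    (h : D.Walk v l w) (hx : ∀ e ∈ l, x e = ENNReal.ofReal (b ^ (-ν e))) :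
    D.wt x v l = ENNReal.ofReal (b ^ (-(l.map ν).sum)) := by
  induction l generalizing v with
  | nil => simp [wt]
  | cons e l ih =>
    obtain ⟨h1, h2⟩ := h
    rw [wt, if_pos h1, ih _ h2 (fun f hf => hx f (by simp [hf])), hx e (by simp),
      ← ENNReal.ofReal_mul (by positivity), ← Real.rpow_add hb]
    simp only [List.map_cons, List.sum_cons]
    congr 2; ring

theorem walk_of_wt_ne_zero (x : E → ENNReal) (l : List E) (v : V)
    (h : D.wt x v l ≠ 0) : ∃ w, D.Walk v l w ∧ ∀ e ∈ l, x e ≠ 0 := by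
  induction l generalizing v with
  | nil => exact ⟨v, rfl, by simp⟩
  | cons e l ih =>
    rw [wt] at h
    split_ifs at h with h1
    · obtain ⟨w, hw, hx⟩ := ih _ (right_ne_zero_of_mul h)
      refine ⟨w, ⟨h1, hw⟩, ?_⟩
      intro f hf
      rcases List.mem_cons.1 hf with rfl | hf
      · exact left_ne_zero_of_mul h
      · exact hx f hf
    · exact absurd rfl h

theorem weight_le_of_walk (β ν : E → ℝ)
    (h : ∀ l v, D.Walk v l v → (l.map ν).sum ≤ (l.map β).sum) (c : D.Cycle) :
    D.weight ν c ≤ D.weight β c := by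
  induction c using Quotient.inductionOn with
  | _ l =>
    obtain ⟨_, v, hv⟩ := (D.isCycleWord_iff l.1).1 l.2
    exact h _ _ hv

theorem count [Fintype V] (ν β : E → ℝ) (b : ℝ) (hb : 1 < b)
    (hG : ∀ v, D.genF (fun e => ENNReal.ofReal (b ^ (-ν e))) v ≠ ⊤)
    (hle : ∀ c : D.Cycle, D.weight ν c ≤ D.weight β c) :
    ∃ C : ℝ, 0 < C ∧ ∀ L : ℝ, {c : D.Cycle | D.weight β c ≤ L}.Finite ∧
      ({c : D.Cycle | D.weight β c ≤ L}.ncard : ℝ) ≤ C * b ^ L := by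
  set x : E → ENNReal := fun e => ENNReal.ofReal (b ^ (-ν e)) with hx
  have hb0 : 0 < b := by linarith
  set T : ENNReal := ∑ v, D.genF x v with hT
  have hTtop : T ≠ ⊤ := by
    rw [hT]; exact ENNReal.sum_ne_top.2 fun v _ => hG v
  refine ⟨T.toReal + 1, by positivity, fun L => ?_⟩
  set S := {c : D.Cycle | D.weight β c ≤ L} with hS
  let rep : D.Cycle → List E := fun c => (Quotient.out c).1
  have hrep : Function.Injective rep := by
    intro c d h
    have : Quotient.out c = Quotient.out d := Subtype.ext h
    rw [← Quotient.out_eq c, ← Quotient.out_eq d, this]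
  have h1 : ∀ c ∈ S, ENNReal.ofReal (b ^ (-L)) ≤ ∑ v, D.wt x v (rep c) := by
    intro c hc
    obtain ⟨_, v, hv⟩ := (D.isCycleWord_iff _).1 (Quotient.out c).2
    refine le_trans ?_ (Finset.single_le_sum (fun _ _ => zero_le) (Finset.mem_univ v))
    rw [D.wt_eq b hb0 x ν _ v v hv (fun e _ => rfl)]
    apply ENNReal.ofReal_le_ofReal
    apply Real.rpow_le_rpow_of_exponent_le hb.le
    have h2 : D.weight ν c = ((rep c).map ν).sum := by
      conv_lhs => rw [← Quotient.out_eq c]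
      rfl
    have h3 : D.weight β c ≤ L := hc
    have := hle c
    change -L ≤ -((rep c).map ν).sum
    linarith
  have h2 : (S.encard : ENNReal) * ENNReal.ofReal (b ^ (-L)) ≤ T := by
    rw [← ENNReal.tsum_set_const]
    calc ∑' _ : S, ENNReal.ofReal (b ^ (-L)) ≤ ∑' c : S, ∑ v, D.wt x v (rep c) :=
          ENNReal.tsum_le_tsum fun c => h1 c c.2
      _ ≤ ∑' l, ∑ v, D.wt x v l :=
          ENNReal.tsum_comp_le_tsum_of_injective (f := fun c : S => rep c)
            (hrep.comp Subtype.val_injective) (fun l => ∑ v, D.wt x v l)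
      _ = T := by
          rw [Summable.tsum_finsetSum (fun _ _ => ENNReal.summable)]
          rfl
  have hpos : 0 < b ^ (-L) := by positivity
  have hfin : S.Finite := by
    rw [← Set.encard_ne_top_iff]
    intro h
    rw [h] at h2
    simp only [ENat.toENNReal_top] at h2
    rw [ENNReal.top_mul (by simpa using hpos)] at h2
    exact hTtop (top_le_iff.1 h2)
  refine ⟨hfin, ?_⟩
  rw [← hfin.cast_ncard_eq] at h2
  have h3 := ENNReal.toReal_mono hTtop h2
  rw [ENNReal.toReal_mul, ENNReal.toReal_ofReal hpos.le] at h3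
  simp only [ENat.toENNReal_coe, ENNReal.toReal_natCast] at h3
  have h4 : b ^ (-L) * b ^ L = 1 := by rw [← Real.rpow_add hb0]; simp
  have h5 : 0 < b ^ L := by positivity
  calc (S.ncard : ℝ) = (S.ncard * b ^ (-L)) * b ^ L := by rw [mul_assoc, h4, mul_one]
    _ ≤ T.toReal * b ^ L := by gcongr
    _ ≤ (T.toReal + 1) * b ^ L := by gcongr; linarith

end Multidigraph

theorem limsup_bound (f : ℝ → ℝ) (hf : ∀ L, 0 ≤ f L) (b C : ℝ) (hb : 0 < b) (hC : 0 < C)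
    (h : ∀ L, f L ≤ C * b ^ L) :
    Filter.IsBoundedUnder (· ≤ ·) Filter.atTop (fun L : ℝ => f L ^ (1 / L)) ∧
    Filter.limsup (fun L : ℝ => f L ^ (1 / L)) Filter.atTop ≤ b := by
  have hle : (fun L : ℝ => f L ^ (1 / L)) ≤ᶠ[Filter.atTop] (fun L : ℝ => C ^ (1 / L) * b) := by
    filter_upwards [Filter.eventually_gt_atTop 0] with L hL
    calc f L ^ (1 / L) ≤ (C * b ^ L) ^ (1 / L) :=
          Real.rpow_le_rpow (hf L) (h L) (by positivity)
      _ = C ^ (1 / L) * b := by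
          rw [Real.mul_rpow hC.le (by positivity), ← Real.rpow_mul hb.le,
            mul_one_div_cancel hL.ne', Real.rpow_one]
  have ht : Filter.Tendsto (fun L : ℝ => C ^ (1 / L) * b) Filter.atTop (nhds b) := by
    have h0 : Filter.Tendsto (fun L : ℝ => 1 / L) Filter.atTop (nhds 0) := by
      simpa using tendsto_inv_atTop_zero (𝕜 := ℝ)
    have := ((Real.continuousAt_const_rpow hC.ne' (b := 0)).tendsto.comp h0).mul_const b
    simpa using this
  have hbd := ht.isBoundedUnder_le
  refine ⟨hbd.mono_le hle, ?_⟩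
  rw [← ht.limsup_eq]
  refine Filter.limsup_le_limsup hle ?_ hbd
  exact Filter.IsCoboundedUnder.of_frequently_ge (a := 0)
    (Filter.Frequently.of_forall fun L => Real.rpow_nonneg (hf L) _)

namespace Multidigraph

variable {V E : Type} (D : Multidigraph V E)

theorem exists_eps [Fintype V] [Fintype E] (β : E → ℝ) (hβ : ∀ c : D.Cycle, 0 < D.weight β c) :
    ∃ ε : ℝ, 0 < ε ∧ ∀ l v, D.Walk v l v → ε * l.length ≤ (l.map β).sum := by
  have h1 : ∀ᶠ ε in nhdsWithin (0:ℝ) (Set.Ioi 0), ∀ l ∈ {l : List E | l.length ≤ Fintype.card V},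
      (∃ v, D.Walk v l v) → ε * l.length ≤ (l.map β).sum := by
    rw [Filter.eventually_all_finite (finite_short _)]
    intro l _
    by_cases hl : ∃ v, D.Walk v l v
    · by_cases hn : l = []
      · subst hn; simp
      · have hpos : 0 < (l.map β).sum :=
          hβ (Quotient.mk D.cycleSetoid ⟨l, (D.isCycleWord_iff l).2 ⟨hn, hl⟩⟩)
        have ht : Filter.Tendsto (fun ε : ℝ => ε * l.length) (nhdsWithin (0:ℝ) (Set.Ioi 0))
            (nhds 0) := by
          have : Filter.Tendsto (fun ε : ℝ => ε * l.length) (nhds 0) (nhds (0 * l.length)) :=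
            (continuous_id.mul continuous_const).tendsto 0
          rw [zero_mul] at this
          exact this.mono_left nhdsWithin_le_nhds
        filter_upwards [ht.eventually_lt_const hpos] with ε h _ using h.le
    · exact Filter.Eventually.of_forall fun ε h => absurd h hl
  obtain ⟨ε, h2, h3⟩ := (h1.and self_mem_nhdsWithin).exists
  refine ⟨ε, h3, ?_⟩
  have key : ∀ l : List E, (l.map (fun _ => ε)).sum = ε * l.length := by
    intro l; simp [mul_comm]
  intro l v hl
  rw [← key]
  exact D.le_of_short β (fun _ => ε) (fun l v h h' => by rw [key]; exact h2 l h ⟨v, h'⟩) l v hl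

theorem base_count [Fintype V] [Fintype E] (β : E → ℝ) (hβ : ∀ c : D.Cycle, 0 < D.weight β c) :
    ∃ b C : ℝ, 1 < b ∧ 0 < C ∧ ∀ L : ℝ, {c : D.Cycle | D.weight β c ≤ L}.Finite ∧
      ({c : D.Cycle | D.weight β c ≤ L}.ncard : ℝ) ≤ C * b ^ L := by
  classical
  obtain ⟨ε, hε, h⟩ := D.exists_eps β hβ
  set m : ℝ := 2 * Fintype.card E + 2 with hm
  have hm1 : 1 < m := by
    have : (0:ℝ) ≤ Fintype.card E := by positivity
    linarith
  have hm0 : 0 < m := by linarith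
  set b : ℝ := m ^ (1 / ε) with hb
  have hb1 : 1 < b := Real.one_lt_rpow hm1 (by positivity)
  have hbε : b ^ (-ε) = m⁻¹ := by
    rw [hb, ← Real.rpow_mul hm0.le]
    have : 1 / ε * -ε = -1 := by field_simp
    rw [this, Real.rpow_neg_one]
  have hG : ∀ v, D.genF (fun e => ENNReal.ofReal (b ^ (-(fun _ : E => ε) e))) v ≠ ⊤ := by
    intro v
    refine ne_top_of_le_ne_top (b := 2) (by simp) (D.genF_le _ (fun _ => 2) ?_ v)
    intro v
    have h1 : ∑ e, (if D.src e = v then ENNReal.ofReal (b ^ (-(fun _ : E => ε) e)) * 2 else 0)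
        ≤ 1 := by
      calc _ ≤ ∑ _e : E, ENNReal.ofReal (m⁻¹ * 2) := by
            refine Finset.sum_le_sum fun e _ => ?_
            split_ifs
            · simp only [hbε]
              rw [ENNReal.ofReal_mul (by positivity)]
              simp
            · exact zero_le
        _ = ENNReal.ofReal (Fintype.card E * (m⁻¹ * 2)) := by
            rw [Finset.sum_const, nsmul_eq_mul, ENNReal.ofReal_mul (p := (Fintype.card E : ℝ)) (by positivity),
              ENNReal.ofReal_natCast, Finset.card_univ]
        _ ≤ 1 := by
            rw [ENNReal.ofReal_le_one]
            have : (Fintype.card E : ℝ) * (m⁻¹ * 2) = (2 * Fintype.card E) / m := by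
              field_simp
            rw [this, div_le_one hm0]
            linarith
    calc _ ≤ (1:ENNReal) + 1 := by gcongr
      _ = 2 := one_add_one_eq_two
  obtain ⟨C, hC, hC'⟩ := D.count (fun _ => ε) β b hb1 hG (D.weight_le_of_walk β _ (fun l v hl => by
    have := h l v hl
    simpa [mul_comm] using this))
  exact ⟨b, C, hb1, hC, hC'⟩

open Classical in
theorem sub_closed_sum [Fintype V] [Fintype E] (S : Set E) (α : E → ℝ) (ε : ℝ) (hε : 0 < ε)
    (hlen : ∀ l v, D.Walk v l v → (∀ e ∈ l, e ∈ S) → ε * l.length ≤ (l.map α).sum)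
    (b0 b : ℝ) (hb0 : 1 < b0) (hb : b0 < b)
    (hfin : ∀ L : ℝ, {c : D.Cycle | D.CycleIn S c ∧ D.weight α c ≤ L}.Finite)
    (hN : ∀ᶠ L : ℝ in Filter.atTop,
      ({c : D.Cycle | D.CycleIn S c ∧ D.weight α c ≤ L}.ncard : ℝ) ≤ b0 ^ L) :
    ∑' l : List E, (if (∃ v, D.Walk v l v) ∧ ∀ e ∈ l, e ∈ S then
      ENNReal.ofReal (b ^ (-(l.map α).sum)) else 0) ≠ ⊤ := by
  have hbpos : 0 < b := by linarith
  set N : ℝ → Set D.Cycle := fun L => {c : D.Cycle | D.CycleIn S c ∧ D.weight α c ≤ L} with hNdef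
  let A : ℕ → Set (List E) := fun n =>
    {l | ((∃ v, D.Walk v l v) ∧ ∀ e ∈ l, e ∈ S) ∧ (l.map α).sum ≤ n + 1}
  let K : ℕ → ℕ := fun n => ⌊((n:ℝ) + 1) / ε⌋₊ + 1
  have hsub : ∀ n : ℕ, A n ⊆ insert [] ((fun p : D.Cycle × ℕ => (Quotient.out p.1).1.rotate p.2) ''
      (N (n+1) ×ˢ (Set.Iio (K n)))) := by
    rintro n l ⟨⟨⟨v, hv⟩, hlS⟩, hl⟩
    by_cases hn : l = []
    · left; exact hn
    right
    have hcw : D.IsCycleWord l := (D.isCycleWord_iff l).2 ⟨hn, v, hv⟩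
    let c : D.Cycle := Quotient.mk D.cycleSetoid ⟨l, hcw⟩
    have hrot : List.IsRotated (Quotient.out c).1 l :=
      Quotient.exact (s := D.cycleSetoid) (Quotient.out_eq c)
    obtain ⟨k, hk, hk'⟩ := List.isRotated_iff_mod.1 hrot
    have hl' := hlen l v hv hlS
    refine ⟨(c, k % (Quotient.out c).1.length), ⟨⟨?_, hl⟩, ?_⟩, ?_⟩
    · exact (D.cycleIn_mk S _).2 hlS
    · have hlpos : 0 < (Quotient.out c).1.length := by
        rw [hrot.perm.length_eq]; exact List.length_pos_iff.2 hn
      have h1 : k % (Quotient.out c).1.length < l.length := by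
        have := Nat.mod_lt k hlpos
        rwa [hrot.perm.length_eq] at this ⊢
      have h2 : l.length ≤ ⌊((n:ℝ) + 1) / ε⌋₊ := by
        apply Nat.le_floor
        rw [le_div_iff₀ hε]
        linarith
      change k % (Quotient.out c).1.length < ⌊((n:ℝ) + 1) / ε⌋₊ + 1
      omega
    · change (Quotient.out c).1.rotate (k % (Quotient.out c).1.length) = l
      rw [List.rotate_mod]; exact hk'
  have hfin2 : ∀ n : ℕ, (N (n+1) ×ˢ (Set.Iio (K n))).Finite := fun n =>
    (hfin _).prod (Set.finite_Iio _)
  have hAfin : ∀ n, (A n).Finite := fun n =>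
    (((hfin2 n).image _).insert _).subset (hsub n)
  have hAcard : ∀ n, (A n).ncard ≤ (N (n+1)).ncard * K n + 1 := by
    intro n
    calc (A n).ncard ≤ _ := Set.ncard_le_ncard (hsub n) (((hfin2 n).image _).insert _)
      _ ≤ _ := Set.ncard_insert_le _ _
      _ ≤ (N (n+1) ×ˢ (Set.Iio (K n))).ncard + 1 := by
          gcongr; exact Set.ncard_image_le (hfin2 n)
      _ = _ := by
          rw [Set.ncard_prod]
          simp [Set.ncard_eq_toFinset_card']
  have hsumm : Summable (fun n : ℕ => ((A n).ncard : ℝ) * b ^ (-(n:ℝ))) := by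
    set r : ℝ := b0 / b with hr
    have hr0 : 0 ≤ r := by positivity
    have hr1 : r < 1 := (div_lt_one hbpos).2 hb
    have hg : Summable (fun n : ℕ => (((n:ℝ) ^ 1 * r ^ n) + r ^ n) * ((1 / ε + 2) * b0)) := by
      apply Summable.mul_right
      apply Summable.add
      · exact summable_pow_mul_geometric_of_norm_lt_one 1 (by
          rwa [Real.norm_eq_abs, abs_of_nonneg hr0])
      · exact summable_geometric_of_lt_one hr0 hr1
    refine Summable.of_norm_bounded_eventually_nat hg ?_
    have ht : Filter.Tendsto (fun n : ℕ => (n:ℝ) + 1) Filter.atTop Filter.atTop :=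
      Filter.tendsto_atTop_add_const_right _ _ tendsto_natCast_atTop_atTop
    filter_upwards [ht.eventually hN] with n hn
    rw [Real.norm_eq_abs, abs_of_nonneg (by positivity)]
    have h1 : ((A n).ncard : ℝ) ≤ (N (n+1)).ncard * K n + 1 := by exact_mod_cast hAcard n
    have h2 : (K n : ℝ) ≤ ((n:ℝ) + 1) / ε + 1 := by
      simp only [K]; push_cast
      gcongr
      exact Nat.floor_le (by positivity)
    have hp : b0 ^ ((n:ℝ) + 1) = b0 ^ n * b0 := by
      rw [← pow_succ]; exact_mod_cast Real.rpow_natCast b0 (n+1)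
    rw [hp] at hn
    have hp1 : 1 ≤ b0 ^ n * b0 := by
      rw [← pow_succ]; exact one_le_pow₀ hb0.le
    have h3 : ((A n).ncard : ℝ) ≤ (n + 1) * ((1 / ε + 2)) * (b0 ^ n * b0) := by
      calc ((A n).ncard : ℝ) ≤ (N (n+1)).ncard * K n + 1 := h1
        _ ≤ (b0 ^ n * b0) * (((n:ℝ) + 1) / ε + 1) + (b0 ^ n * b0) := by gcongr
        _ = (((n:ℝ) + 1) / ε + 2) * (b0 ^ n * b0) := by ring
        _ ≤ _ := by
          gcongr
          have : (0:ℝ) ≤ n := by positivity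
          rw [mul_add, mul_one_div]
          linarith
    rw [Real.rpow_neg hbpos.le, Real.rpow_natCast]
    calc ((A n).ncard : ℝ) * (b ^ n)⁻¹ ≤ (n + 1) * ((1 / ε + 2)) * (b0 ^ n * b0) * (b ^ n)⁻¹ := by
          gcongr
      _ = _ := by rw [hr, div_pow]; ring
  have hterm : ∀ l : List E, (if (∃ v, D.Walk v l v) ∧ ∀ e ∈ l, e ∈ S then
      ENNReal.ofReal (b ^ (-(l.map α).sum)) else 0) ≤
      ∑' n : ℕ, (A n).indicator (fun _ => ENNReal.ofReal (b ^ (-(n:ℝ)))) l := by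
    intro l
    split_ifs with h
    · obtain ⟨⟨v, hv⟩, hS⟩ := h
      have h0 : 0 ≤ (l.map α).sum := le_trans (by positivity) (hlen l v hv hS)
      refine le_trans ?_ (ENNReal.le_tsum ⌊(l.map α).sum⌋₊)
      have hm : l ∈ A ⌊(l.map α).sum⌋₊ := ⟨⟨⟨v, hv⟩, hS⟩, (Nat.lt_floor_add_one _).le⟩
      rw [Set.indicator_of_mem hm]
      apply ENNReal.ofReal_le_ofReal
      apply Real.rpow_le_rpow_of_exponent_le (by linarith)
      exact neg_le_neg (Nat.floor_le h0)
    · exact zero_le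
  refine ne_top_of_le_ne_top ?_ (ENNReal.tsum_le_tsum hterm)
  rw [ENNReal.tsum_comm]
  have : ∀ n : ℕ, ∑' l, (A n).indicator (fun _ => ENNReal.ofReal (b ^ (-(n:ℝ)))) l =
      ENNReal.ofReal (((A n).ncard : ℝ) * b ^ (-(n:ℝ))) := by
    intro n
    rw [← tsum_subtype, ENNReal.tsum_set_const, ← (hAfin n).cast_ncard_eq,
      ENNReal.ofReal_mul (by positivity)]
    simp
  simp_rw [this]
  exact hsumm.tsum_ofReal_ne_top

open Classical in
theorem sub_genF [Fintype V] [Fintype E] (S : Set E) (α : E → ℝ) (b : ℝ) (hb : 1 < b)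
    (hS : ∀ e ∈ S, ∃ l v, D.Walk v l v ∧ e ∈ l ∧ ∀ f ∈ l, f ∈ S)
    (hsum : ∑' l : List E, (if (∃ v, D.Walk v l v) ∧ ∀ e ∈ l, e ∈ S then
      ENNReal.ofReal (b ^ (-(l.map α).sum)) else 0) ≠ ⊤) (v : V) :
    D.genF (fun e => if e ∈ S then ENNReal.ofReal (b ^ (-α e)) else 0) v ≠ ⊤ := by
  have hbpos : 0 < b := by linarith
  set x : E → ENNReal := fun e => if e ∈ S then ENNReal.ofReal (b ^ (-α e)) else 0 with hx
  set F : List E → ENNReal := fun l => if (∃ v, D.Walk v l v) ∧ ∀ e ∈ l, e ∈ S then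
      ENNReal.ofReal (b ^ (-(l.map α).sum)) else 0 with hF
  have hq : ∀ u, ∃ q : List E, (∃ q', D.Walk u q' v ∧ ∀ e ∈ q', e ∈ S) →
      D.Walk u q v ∧ ∀ e ∈ q, e ∈ S := by
    intro u
    by_cases h : ∃ q', D.Walk u q' v ∧ ∀ e ∈ q', e ∈ S
    · obtain ⟨q, hq⟩ := h
      exact ⟨q, fun _ => hq⟩
    · exact ⟨[], fun h' => absurd h' h⟩
  choose q hq using hq
  have key : ∀ l, D.wt x v l ≤ ∑ u, ENNReal.ofReal (b ^ ((q u).map α).sum) * F (l ++ q u) := by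
    intro l
    by_cases h0 : D.wt x v l = 0
    · rw [h0]; exact zero_le
    obtain ⟨w, hw, hlS⟩ := D.walk_of_wt_ne_zero x l v h0
    have hlS' : ∀ e ∈ l, e ∈ S := by
      intro e he
      by_contra hc
      exact hlS e he (by simp [hx, hc])
    obtain ⟨h1, h2⟩ := hq w (D.walk_return S hS l v w hw hlS')
    refine le_trans (le_of_eq ?_) (Finset.single_le_sum (fun _ _ => zero_le) (Finset.mem_univ w))
    rw [D.wt_eq b hbpos x α l v w hw (fun e he => by simp [hx, hlS' e he])]
    have h3 : F (l ++ q w) = ENNReal.ofReal (b ^ (-((l ++ q w).map α).sum)) := by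
      simp only [hF]
      rw [if_pos]
      refine ⟨⟨v, (D.walk_append _ _ _ _).2 ⟨w, hw, h1⟩⟩, ?_⟩
      intro e he
      rcases List.mem_append.1 he with he | he
      · exact hlS' e he
      · exact h2 e he
    rw [h3, ← ENNReal.ofReal_mul (by positivity), ← Real.rpow_add hbpos]
    simp only [List.map_append, List.sum_append]
    congr 2; ring
  rw [genF]
  refine ne_top_of_le_ne_top ?_ (ENNReal.tsum_le_tsum key)
  rw [Summable.tsum_finsetSum (fun _ _ => ENNReal.summable)]
  refine ENNReal.sum_ne_top.2 fun u _ => ?_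
  rw [ENNReal.tsum_mul_left]
  refine ENNReal.mul_ne_top ENNReal.ofReal_ne_top ?_
  exact ne_top_of_le_ne_top hsum (ENNReal.tsum_comp_le_tsum_of_injective
    (f := fun l => l ++ q u) (fun a b h => List.append_cancel_right h) F)

open Classical in
theorem full_genF [Fintype V] [Fintype E] (S : Set E) (α : E → ℝ) (b : ℝ) (hb : 1 < b)
    (hG : ∀ v, D.genF (fun e => if e ∈ S then ENNReal.ofReal (b ^ (-α e)) else 0) v ≠ ⊤) :
    ∃ N : ℝ, ∀ v, D.genF (fun e => ENNReal.ofReal (b ^ (-(if e ∈ S then α e else N)))) v ≠ ⊤ := by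
  have hbpos : 0 < b := by linarith
  set x : E → ENNReal := fun e => if e ∈ S then ENNReal.ofReal (b ^ (-α e)) else 0 with hx
  set f : V → ENNReal := fun v => D.genF x v with hf
  set P : ENNReal := ∑ v, f v with hP
  have hPtop : P ≠ ⊤ := ENNReal.sum_ne_top.2 fun v _ => hG v
  have hfP : ∀ v, f v ≤ P := fun v =>
    Finset.single_le_sum (f := f) (fun _ _ => zero_le) (Finset.mem_univ v)
  -- choose `N`
  have ht : Filter.Tendsto (fun N : ℝ => (Fintype.card E : ℝ) * (b ^ (-N) * (2 * P.toReal)))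
      Filter.atTop (nhds 0) := by
    have h1 : Filter.Tendsto (fun N : ℝ => b ^ (-N)) Filter.atTop (nhds 0) := by
      have := tendsto_rpow_atTop_of_base_lt_one b⁻¹ (by linarith [inv_pos.2 hbpos])
        (inv_lt_one_of_one_lt₀ hb)
      refine this.congr fun N => ?_
      rw [Real.inv_rpow hbpos.le, Real.rpow_neg hbpos.le]
    have := (h1.mul_const (2 * P.toReal)).const_mul (Fintype.card E : ℝ)
    simpa using this
  obtain ⟨N, hN⟩ := (ht.eventually_lt_const one_pos).exists
  refine ⟨N, fun v => ?_⟩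
  refine ne_top_of_le_ne_top (ENNReal.mul_ne_top (ENNReal.ofNat_ne_top (n := 2)) (hG v))
    (D.genF_le _ (fun v => 2 * f v) ?_ v)
  intro v
  have hstep : ∑ e, (if D.src e = v then
      ENNReal.ofReal (b ^ (-(if e ∈ S then α e else N))) * (2 * f (D.tgt e)) else 0) ≤
      2 * (∑ e, if D.src e = v then x e * f (D.tgt e) else 0) +
        ∑ _e : E, ENNReal.ofReal (b ^ (-N)) * (2 * P) := by
    rw [Finset.mul_sum, ← Finset.sum_add_distrib]
    refine Finset.sum_le_sum fun e _ => ?_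
    split_ifs with h1 h2
    · simp only [hx, h2, if_true]
      rw [mul_left_comm]
      exact le_self_add
    · refine le_trans ?_ le_add_self
      gcongr
      exact hfP _
    · exact zero_le
  have hsm : ∑ _e : E, ENNReal.ofReal (b ^ (-N)) * (2 * P) ≤ 1 := by
    rw [Finset.sum_const, nsmul_eq_mul, ← ENNReal.ofReal_toReal hPtop]
    have : ((Finset.univ : Finset E).card : ENNReal) * (ENNReal.ofReal (b ^ (-N)) *
        (2 * ENNReal.ofReal P.toReal)) =
        ENNReal.ofReal ((Fintype.card E : ℝ) * (b ^ (-N) * (2 * P.toReal))) := by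
      rw [ENNReal.ofReal_mul (by positivity), ENNReal.ofReal_mul (by positivity),
        ENNReal.ofReal_mul (by positivity)]
      simp
    rw [Finset.card_univ] at this ⊢
    rw [this, ENNReal.ofReal_le_one]
    exact hN.le
  calc _ ≤ (1:ENNReal) + (2 * (∑ e, if D.src e = v then x e * f (D.tgt e) else 0) + 1) := by
        gcongr; exact hstep.trans (by gcongr)
    _ = 2 * (1 + ∑ e, if D.src e = v then x e * f (D.tgt e) else 0) := by ring
    _ = 2 * f v := by
        simp only [hf]; rw [← D.genF_eq x v]

end Multidigraph

/-- Lemma `lem:rates_converge`.  Let `D` be a finite directed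
multigraph and `D'` the subgraph with edge set `E'`.  Let `α` be an edge weighting
positive on every directed cycle of `D'` and let `αs i` be edge weightings of `D`,
each positive on every directed cycle of `D`, such that (1) they agree with `α` on
cycles contained in `D'`, (2) they blow up on every cycle not contained in `D'`,
and (3) `liminf_i gr_D(αs i) > 1`.  Then `gr_D(αs i) ≥ gr_{D'}(α)` for every `i`,
and `gr_D(αs i) → gr_{D'}(α)` as `i → ∞`. -/
theorem growthRate_tendsto_of_blowup
    {V E : Type} [Fintype V] [Fintype E] (D : Multidigraph V E)
    (E' : Set E) (α : E → ℝ) (αs : ℕ → E → ℝ)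
    (hα : ∀ c : D.Cycle, D.CycleIn E' c → 0 < D.weight α c)
    (hαs : ∀ i, ∀ c : D.Cycle, 0 < D.weight (αs i) c)
    (h1 : ∀ i, ∀ c : D.Cycle, D.CycleIn E' c → D.weight (αs i) c = D.weight α c)
    (h2 : ∀ c : D.Cycle, ¬ D.CycleIn E' c →
      Filter.Tendsto (fun i => D.weight (αs i) c) Filter.atTop Filter.atTop)
    (h3 : 1 < Filter.liminf (fun i => D.growthRate (αs i)) Filter.atTop) :
    (∀ i, D.growthRateOn E' α ≤ D.growthRate (αs i)) ∧
      Filter.Tendsto (fun i => D.growthRate (αs i)) Filter.atTop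
        (nhds (D.growthRateOn E' α)) := by
  classical
  -- counting sets in `ncard` form
  have hcard : ∀ β : E → ℝ, D.growthRate β = Filter.limsup (fun L : ℝ =>
      ({c : D.Cycle | D.weight β c ≤ L}.ncard : ℝ) ^ (1 / L)) Filter.atTop := by
    intro β
    unfold Multidigraph.growthRate Multidigraph.growthRateOn
    have : ∀ L : ℝ, {c : D.Cycle | D.CycleIn Set.univ c ∧ D.weight β c ≤ L} =
        {c : D.Cycle | D.weight β c ≤ L} := by
      intro L; ext c; simp [Multidigraph.CycleIn]
    simp only [this]
    rfl
  have hcard' : D.growthRateOn E' α = Filter.limsup (fun L : ℝ =>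
      ({c : D.Cycle | D.CycleIn E' c ∧ D.weight α c ≤ L}.ncard : ℝ) ^ (1 / L)) Filter.atTop := rfl
  have hsubset : ∀ i (L : ℝ), {c : D.Cycle | D.CycleIn E' c ∧ D.weight α c ≤ L} ⊆
      {c : D.Cycle | D.weight (αs i) c ≤ L} := by
    rintro i L c ⟨hc, hL⟩
    change D.weight (αs i) c ≤ L
    rw [h1 i c hc]; exact hL
  have hbase := fun i => D.base_count (αs i) (hαs i)
  have hfinE : ∀ L : ℝ, {c : D.Cycle | D.CycleIn E' c ∧ D.weight α c ≤ L}.Finite := by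
    intro L
    obtain ⟨b, C, _, _, h⟩ := hbase 0
    exact (h L).1.subset (hsubset 0 L)
  have hmono : ∀ i (L : ℝ), ({c : D.Cycle | D.CycleIn E' c ∧ D.weight α c ≤ L}.ncard : ℝ) ≤
      ({c : D.Cycle | D.weight (αs i) c ≤ L}.ncard : ℝ) := by
    intro i L
    obtain ⟨b, C, _, _, h⟩ := hbase i
    exact_mod_cast Set.ncard_le_ncard (hsubset i L) (h L).1
  have hbdE : Filter.IsBoundedUnder (· ≤ ·) Filter.atTop (fun L : ℝ =>
      ({c : D.Cycle | D.CycleIn E' c ∧ D.weight α c ≤ L}.ncard : ℝ) ^ (1 / L)) := by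
    obtain ⟨b, C, hb, hC, h⟩ := hbase 0
    exact (limsup_bound _ (fun L => by positivity) b C (by linarith) hC
      (fun L => (hmono 0 L).trans (h L).2)).1
  have hge : ∀ i, D.growthRateOn E' α ≤ D.growthRate (αs i) := by
    intro i
    rw [hcard, hcard']
    obtain ⟨b, C, hb, hC, h⟩ := hbase i
    refine Filter.limsup_le_limsup ?_ ?_ (limsup_bound _ (fun L => by positivity) b C
      (by linarith) hC (fun L => (h L).2)).1
    · filter_upwards [Filter.eventually_gt_atTop 0] with L hL
      exact Real.rpow_le_rpow (by positivity) (hmono i L) (by positivity)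
    · exact Filter.IsCoboundedUnder.of_frequently_ge (a := 0)
        (Filter.Frequently.of_forall fun L => by positivity)
  refine ⟨hge, ?_⟩
  -- the edges lying on a cycle of the subgraph
  let S : Set E := {e | ∃ l v, D.Walk v l v ∧ e ∈ l ∧ ∀ f ∈ l, f ∈ E'}
  have hSE : S ⊆ E' := by
    rintro e ⟨l, v, _, he, hl⟩
    exact hl e he
  have hES : ∀ l v, D.Walk v l v → (∀ e ∈ l, e ∈ E') → ∀ e ∈ l, e ∈ S :=
    fun l v hl h e he => ⟨l, v, hl, he, h⟩
  have hS : ∀ e ∈ S, ∃ l v, D.Walk v l v ∧ e ∈ l ∧ ∀ f ∈ l, f ∈ S := by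
    rintro e ⟨l, v, hl, he, h⟩
    exact ⟨l, v, hl, he, hES l v hl h⟩
  have hCyc : ∀ c : D.Cycle, D.CycleIn S c ↔ D.CycleIn E' c := by
    intro c
    induction c using Quotient.inductionOn with
    | _ l =>
      rw [D.cycleIn_mk, D.cycleIn_mk]
      obtain ⟨_, v, hv⟩ := (D.isCycleWord_iff l.1).1 l.2
      exact ⟨fun h e he => hSE (h e he), fun h => hES _ v hv h⟩
  have hwalkeq : ∀ i l v, D.Walk v l v → (∀ e ∈ l, e ∈ E') →
      (l.map (αs i)).sum = (l.map α).sum := by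
    intro i l v hl hlE
    by_cases hn : l = []
    · subst hn; simp
    · exact h1 i (Quotient.mk D.cycleSetoid ⟨l, (D.isCycleWord_iff l).2 ⟨hn, v, hl⟩⟩)
        ((D.cycleIn_mk _ _).2 hlE)
  -- the main upper bound
  have hupper : ∀ b, 1 < b → D.growthRateOn E' α < b →
      ∀ᶠ i in Filter.atTop, D.growthRate (αs i) ≤ b := by
    intro b hb hgb
    obtain ⟨b0, hb0, hb0b⟩ := exists_between (max_lt hb hgb)
    have hb01 : 1 < b0 := (le_max_left _ _).trans_lt hb0
    have hb0g : D.growthRateOn E' α < b0 := (le_max_right _ _).trans_lt hb0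
    have hev := Filter.eventually_lt_of_limsup_lt (hcard' ▸ hb0g) hbdE
    have hN : ∀ᶠ L : ℝ in Filter.atTop,
        ({c : D.Cycle | D.CycleIn S c ∧ D.weight α c ≤ L}.ncard : ℝ) ≤ b0 ^ L := by
      filter_upwards [hev, Filter.eventually_gt_atTop 0] with L h hL
      simp only [hCyc]
      have h' := Real.rpow_le_rpow (by positivity) h.le hL.le
      rwa [← Real.rpow_mul (by positivity), one_div_mul_cancel hL.ne', Real.rpow_one] at h'
    obtain ⟨ε, hε, hlen⟩ := D.exists_eps (αs 0) (hαs 0)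
    have hlen' : ∀ l v, D.Walk v l v → (∀ e ∈ l, e ∈ S) → ε * l.length ≤ (l.map α).sum := by
      intro l v hl hlS
      rw [← hwalkeq 0 l v hl (fun e he => hSE (hlS e he))]
      exact hlen l v hl
    have hsum := D.sub_closed_sum S α ε hε hlen' b0 b hb01 hb0b
      (fun L => by simp only [hCyc]; exact hfinE L) hN
    obtain ⟨N, hG⟩ := D.full_genF S α b hb (D.sub_genF S α b hb hS hsum)
    set ν : E → ℝ := fun e => if e ∈ S then α e else N with hν
    have hshort : ∀ᶠ i in Filter.atTop, ∀ l ∈ {l : List E | l.length ≤ Fintype.card V},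
        (∃ v, D.Walk v l v) → (l.map ν).sum ≤ (l.map (αs i)).sum := by
      rw [Filter.eventually_all_finite (Multidigraph.finite_short _)]
      intro l _
      by_cases hl : ∃ v, D.Walk v l v
      · by_cases hlE : ∀ e ∈ l, e ∈ E'
        · refine Filter.Eventually.of_forall fun i _ => ?_
          obtain ⟨v, hv⟩ := hl
          rw [hwalkeq i l v hv hlE]
          refine le_of_eq (congrArg List.sum (List.map_congr_left fun e he => ?_))
          simp only [hν]
          rw [if_pos (hES l v hv hlE e he)]
        · have hn : l ≠ [] := by rintro rfl; simp at hlE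
          have ht := h2 (Quotient.mk D.cycleSetoid ⟨l, (D.isCycleWord_iff l).2 ⟨hn, hl⟩⟩)
            (fun h => hlE ((D.cycleIn_mk _ _).1 h))
          filter_upwards [ht.eventually_ge_atTop (l.map ν).sum] with i hi _
          exact hi
      · exact Filter.Eventually.of_forall fun i h => absurd h hl
    filter_upwards [hshort] with i hi
    have hle := D.weight_le_of_walk (αs i) ν
      (D.le_of_short (αs i) ν (fun l v h h' => hi l h ⟨v, h'⟩))
    obtain ⟨C, hC, hC'⟩ := D.count ν (αs i) b hb hG hle
    rw [hcard]
    exact (limsup_bound _ (fun L => by positivity) b C (by linarith) hC (fun L => (hC' L).2)).2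
  -- conclusion
  have hg0 : 0 ≤ D.growthRateOn E' α := by
    rw [hcard']
    exact Filter.le_limsup_of_frequently_le
      (Filter.Frequently.of_forall fun L => by positivity) hbdE
  obtain ⟨a, ha1, ha2⟩ := exists_between h3
  have hlow : ∀ᶠ i in Filter.atTop, a < D.growthRate (αs i) :=
    Filter.eventually_lt_of_lt_liminf ha2
      ⟨D.growthRateOn E' α, by simpa using Filter.Eventually.of_forall (f := Filter.atTop) hge⟩
  have hg1 : 1 < D.growthRateOn E' α := by
    by_contra hc
    push Not at hc
    obtain ⟨i, hi1, hi2⟩ := (hlow.and (hupper a ha1 (by linarith))).exists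
    linarith
  rw [tendsto_order]
  constructor
  · intro c hc
    exact Filter.Eventually.of_forall fun i => hc.trans_le (hge i)
  · intro c hc
    filter_upwards [hupper ((D.growthRateOn E' α + c) / 2) (by linarith) (by linarith)] with i hi
    linarith
end

section
/- Let Q = [0,1]² and let u, v : Q → ℝ² be continuous vector fields such that: (i) u(x) and v(x) are linearly independent for every x ∈ Q; (ii) the first coordinate of u is strictly positive and the second coordinate of v is strictly positive at every point of Q; (iii) the second coordinate of u vanishes at every point of the bottom and top edges [0,1]×{0} and [0,1]×{1}, and the first coordinate of v vanishes at every point of the left and right edges {0}×[0,1] and {1}×[0,1]; and (iv) u and v are uniquely integrable in Q, meaning any two differentiable curves taking values in Q that solve x' = u(x) (respectively x' = v(x)) and agree at one time agree on their common interval of definition. Then there exists a continuously differentiable curve α : [0,1] → Q with α(0) = (0,0), α(1) = (1,1), and such that for every t ∈ [0,1] there exist real numbers a, b > 0 with α'(t) = a·u(α(t)) + b·v(α(t)). -/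
/-- A vector field `w` is uniquely integrable in the region `Q ⊆ ℝ²`: any two
differentiable curves taking values in `Q` that solve `x' = w(x)` (on intervals of
time) and agree at one time agree on their common interval of definition. -/
def UniquelyIntegrableOn (w : ℝ × ℝ → ℝ × ℝ) (Q : Set (ℝ × ℝ)) : Prop :=
  ∀ (γ₁ γ₂ : ℝ → ℝ × ℝ) (s₁ s₂ : Set ℝ), s₁.OrdConnected → s₂.OrdConnected →
    (∀ t ∈ s₁, γ₁ t ∈ Q) → (∀ t ∈ s₁, HasDerivWithinAt γ₁ (w (γ₁ t)) s₁ t) →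
    (∀ t ∈ s₂, γ₂ t ∈ Q) → (∀ t ∈ s₂, HasDerivWithinAt γ₂ (w (γ₂ t)) s₂ t) →
    ∀ t₀ ∈ s₁ ∩ s₂, γ₁ t₀ = γ₂ t₀ → ∀ t ∈ s₁ ∩ s₂, γ₁ t = γ₂ t

open Set Filter Topology

/-- Clamp to the unit square. -/
noncomputable def clampQ (p : ℝ × ℝ) : ℝ × ℝ := (max 0 (min 1 p.1), max 0 (min 1 p.2))

lemma clampQ_mem (p : ℝ × ℝ) : clampQ p ∈ Icc (0:ℝ) 1 ×ˢ Icc (0:ℝ) 1 := by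
  simp [clampQ]

lemma clampQ_of_mem {p : ℝ × ℝ} (hp : p ∈ Icc (0:ℝ) 1 ×ˢ Icc (0:ℝ) 1) : clampQ p = p := by
  obtain ⟨⟨h1, h2⟩, h3, h4⟩ := hp
  simp [clampQ, h1, h2, h3, h4]

lemma clampQ_lip : LipschitzWith 1 clampQ := by
  have h1 : LipschitzWith 1 (fun p : ℝ × ℝ => max 0 (min 1 p.1)) :=
    (LipschitzWith.prod_fst.const_min 1).const_max 0
  have h2 : LipschitzWith 1 (fun p : ℝ × ℝ => max 0 (min 1 p.2)) :=
    (LipschitzWith.prod_snd.const_min 1).const_max 0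
  have h := h1.prodMk h2
  rw [max_self] at h
  exact h

lemma persist {a b c : ℝ} {φ φ' : ℝ → ℝ} (hd : ∀ t ∈ Icc a b, HasDerivAt φ (φ' t) t)
    (h0 : c ≤ φ a) (hpos : ∀ t ∈ Icc a b, φ t = c → 0 < φ' t) :
    ∀ t ∈ Ioc a b, c < φ t := by
  have hle : ∀ ⦃t⦄, t ∈ Icc a b → c ≤ φ t := by
    apply image_le_of_deriv_right_lt_deriv_boundary' (f := fun _ => c) (f' := fun _ => 0)
      (B' := φ') continuousOn_const (fun x _ => hasDerivWithinAt_const _ _ _) h0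
      (fun t ht => (hd t ht).continuousAt.continuousWithinAt)
      (fun t ht => (hd t ⟨ht.1, ht.2.le⟩).hasDerivWithinAt)
      (fun t ht h => hpos t ⟨ht.1, ht.2.le⟩ h.symm)
  intro t ht
  have htc : t ∈ Icc a b := ⟨ht.1.le, ht.2⟩
  refine lt_of_le_of_ne (hle htc) fun heq => ?_
  have hp := hpos t htc heq.symm
  have hs := (hasDerivWithinAt_iff_tendsto_slope' (s := Iio t) (by simp)).1
    (hd t htc).hasDerivWithinAt
  have e1 := hs.eventually (lt_mem_nhds hp)
  have e2 : ∀ᶠ s in 𝓝[<] t, s ∈ Ioo a t := Ioo_mem_nhdsLT ht.1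
  obtain ⟨s, h1, h2⟩ := (e1.and e2).exists
  have h3 := hle (t := s) ⟨h2.1.le, h2.2.le.trans ht.2⟩
  rw [slope_def_field, div_pos_iff] at h1
  rcases h1 with h | h
  · linarith [h2.2]
  · linarith [h2.2]

lemma lip_approx {f : ℝ × ℝ → ℝ} (hf : UniformContinuous f) {M : ℝ} (hM : ∀ p, |f p| ≤ M)
    {η : ℝ} (hη : 0 < η) :
    ∃ (K : NNReal) (F : ℝ × ℝ → ℝ), LipschitzWith K F ∧ ∀ p, f p < F p ∧ F p < f p + η := by
  obtain ⟨δ, hδ, hd⟩ := Metric.uniformContinuous_iff.1 hf (η/4) (by positivity)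
  have hM0 : 0 ≤ M := (abs_nonneg _).trans (hM 0)
  set L : ℝ := 2 * M / δ with hL
  have hL0 : 0 ≤ L := by positivity
  set g : ℝ × ℝ → ℝ × ℝ → ℝ := fun p q => f q - L * dist p q with hg
  have hub : ∀ p q, g p q ≤ f p + η / 4 := by
    intro p q
    by_cases h : dist p q < δ
    · have := hd h
      rw [Real.dist_eq, abs_lt] at this
      have : 0 ≤ L * dist p q := by positivity
      simp only [hg]; linarith
    · push Not at h
      have : 2 * M ≤ L * dist p q := by
        calc 2 * M = L * δ := by rw [hL]; field_simp
          _ ≤ _ := by gcongr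
      have h1 := abs_le.1 (hM p)
      have h2 := abs_le.1 (hM q)
      simp only [hg]; linarith
  have hbdd : ∀ p, BddAbove (range (g p)) := fun p => ⟨_, by rintro _ ⟨q, rfl⟩; exact hub p q⟩
  refine ⟨L.toNNReal, fun p => (⨆ q, g p q) + η/4, ?_, fun p => ⟨?_, ?_⟩⟩
  · apply LipschitzWith.of_le_add_mul'
    intro x y
    have : (⨆ q, g x q) ≤ (⨆ q, g y q) + L * dist x y := by
      apply ciSup_le
      intro q
      have h1 := le_ciSup (hbdd y) q
      have h2 : dist y q ≤ dist x y + dist x q := by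
        rw [dist_comm x y]; exact dist_triangle _ _ _
      have h3 := mul_le_mul_of_nonneg_left h2 hL0
      simp only [hg] at h1 ⊢
      linarith
    linarith
  · have h1 := le_ciSup (hbdd p) p
    have : g p p = f p := by simp [hg]
    linarith
  · have := ciSup_le (hub p)
    linarith

lemma limit_curve {f : ℝ × ℝ → ℝ} (hf : Continuous f) {M : ℝ}
    {y d : ℕ → ℝ → ℝ} (h0 : ∀ n, y n 0 = 0)
    (hd : ∀ n, ∀ t ∈ Icc (0:ℝ) 1, HasDerivAt (y n) (d n t) t)
    (hM : ∀ n, ∀ t ∈ Icc (0:ℝ) 1, |d n t| ≤ M)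
    (hfd : ∀ n, ∀ t ∈ Icc (0:ℝ) 1, |d n t - f (t, y n t)| ≤ 1 / ((n:ℝ) + 1)) :
    ∃ (z : ℝ → ℝ) (U : Filter ℕ), U.NeBot ∧
      (∀ t ∈ Icc (0:ℝ) 1, Tendsto (fun n => y n t) U (𝓝 (z t))) ∧
      ∀ t ∈ Icc (0:ℝ) 1, HasDerivWithinAt z (f (t, z t)) (Icc 0 1) t := by
  have hM0 : 0 ≤ M := (abs_nonneg _).trans (hM 0 0 (by simp))
  have hmv : ∀ n, ∀ a ∈ Icc (0:ℝ) 1, ∀ b ∈ Icc (0:ℝ) 1, |y n b - y n a| ≤ M * |b - a| := by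
    intro n a ha b hb
    exact (convex_Icc (0:ℝ) 1).norm_image_sub_le_of_norm_hasDerivWithin_le
      (fun t ht => (hd n t ht).hasDerivWithinAt) (hM n) ha hb
  have hbd : ∀ n, ∀ t ∈ Icc (0:ℝ) 1, y n t ∈ Icc (-M) M := by
    intro n t ht
    have h := hmv n 0 (by simp) t ht
    rw [h0, sub_zero, sub_zero, abs_of_nonneg ht.1] at h
    have : M * t ≤ M := by nlinarith [ht.2]
    exact abs_le.1 (h.trans this)
  let U : Ultrafilter ℕ := hyperfilter ℕ
  have hlim : ∀ t, ∃ l, t ∈ Icc (0:ℝ) 1 → Tendsto (fun n => y n t) U (𝓝 l) := by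
    intro t
    by_cases ht : t ∈ Icc (0:ℝ) 1
    · obtain ⟨l, _, hl⟩ := (isCompact_Icc (a := -M) (b := M)).ultrafilter_le_nhds
        (U.map (fun n => y n t)) (by
          rw [le_principal_iff, Ultrafilter.mem_coe, Ultrafilter.mem_map]
          exact Filter.univ_mem' (fun n => hbd n t ht))
      exact ⟨l, fun _ => hl⟩
    · exact ⟨0, fun h => absurd h ht⟩
  choose z hz using hlim
  have hUat : (U : Filter ℕ) ≤ atTop := by
    rw [← Nat.cofinite_eq_atTop]; exact hyperfilter_le_cofinite
  refine ⟨z, U, inferInstance, hz, ?_⟩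
  intro a ha
  rw [hasDerivWithinAt_iff_isLittleO, Asymptotics.isLittleO_iff]
  intro ε hε
  obtain ⟨δ, hδ, hδf⟩ := Metric.continuousAt_iff.1 (hf.continuousAt (x := (a, z a))) (ε/2)
    (by positivity)
  set ρ := δ / (2 * (M + 1)) with hρ
  have hρ0 : 0 < ρ := by positivity
  have hρ1 : ρ * (M+1) = δ / 2 := by rw [hρ]; field_simp
  have key : ∀ b ∈ Icc (0:ℝ) 1, |b - a| < ρ →
      |z b - z a - (b - a) * f (a, z a)| ≤ ε * |b - a| := by
    intro b hb hba
    have e1 : ∀ᶠ n in (U : Filter ℕ), |y n a - z a| < δ / 2 := by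
      have := (hz a ha).eventually (Metric.ball_mem_nhds (z a) (half_pos hδ))
      simpa [Real.dist_eq] using this
    have e2 : ∀ᶠ n : ℕ in (U : Filter ℕ), 1 / ((n:ℝ) + 1) < ε / 2 :=
      hUat (tendsto_one_div_add_atTop_nhds_zero_nat.eventually (gt_mem_nhds (half_pos hε)))
    have ht : Tendsto (fun n => |y n b - y n a - (b - a) * f (a, z a)|) U
        (𝓝 |z b - z a - (b - a) * f (a, z a)|) :=
      (((hz b hb).sub (hz a ha)).sub tendsto_const_nhds).abs
    refine le_of_tendsto ht ?_
    filter_upwards [e1, e2] with n h1 h2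
    have hsub : uIcc a b ⊆ Icc (0:ℝ) 1 := (convex_Icc (0:ℝ) 1).ordConnected.uIcc_subset ha hb
    have := (convex_uIcc a b).norm_image_sub_le_of_norm_hasDerivWithin_le
      (f := fun t => y n t - t * f (a, z a)) (f' := fun t => d n t - 1 * f (a, z a)) (C := ε)
      (fun t ht => ((hd n t (hsub ht)).sub
        ((hasDerivAt_id t).mul_const (f (a, z a)))).hasDerivWithinAt) ?_
        left_mem_uIcc right_mem_uIcc
    · simp only [Real.norm_eq_abs] at this
      have e : y n b - y n a - (b - a) * f (a, z a)
          = y n b - b * f (a, z a) - (y n a - a * f (a, z a)) := by ring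
      rw [e]
      exact this
    · intro t ht
      have hta : |t - a| ≤ |b - a| := abs_sub_left_of_mem_uIcc ht
      have h3 := hmv n a ha t (hsub ht)
      have h4 : |y n t - z a| < δ := by
        calc |y n t - z a| ≤ |y n t - y n a| + |y n a - z a| := abs_sub_le _ _ _
          _ < ρ * (M + 1) + δ / 2 := by
            have : M * |t - a| ≤ ρ * (M+1) := by nlinarith [abs_nonneg (t - a)]
            linarith
          _ = δ := by rw [hρ1]; ring
      have h5 : |t - a| < δ := by
        have : ρ ≤ ρ * (M + 1) := by nlinarith
        linarith
      have h6 := hδf (x := (t, y n t)) (by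
        rw [Prod.dist_eq]; simpa [Real.dist_eq] using ⟨h5, h4⟩)
      rw [Real.dist_eq] at h6
      have h7 := hfd n t (hsub ht)
      rw [Real.norm_eq_abs, one_mul]
      calc |d n t - f (a, z a)| ≤ |d n t - f (t, y n t)| + |f (t, y n t) - f (a, z a)| :=
            abs_sub_le _ _ _
        _ ≤ ε := by linarith
  have e3 : ∀ᶠ b in 𝓝[Icc 0 1] a, |b - a| < ρ := by
    apply mem_nhdsWithin_of_mem_nhds
    have := Metric.ball_mem_nhds a hρ0
    simpa [Metric.ball, Real.dist_eq] using this
  filter_upwards [e3, self_mem_nhdsWithin] with b h1 h2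
  simpa using key b h2 h1

lemma time_change {u : ℝ × ℝ → ℝ × ℝ} (hu : ContinuousOn u (Icc (0:ℝ) 1 ×ˢ Icc (0:ℝ) 1))
    (hu1 : ∀ x ∈ Icc (0:ℝ) 1 ×ˢ Icc (0:ℝ) 1, 0 < (u x).1)
    {y : ℝ → ℝ} {τ : ℝ} (hτ0 : 0 ≤ τ) (hτ1 : τ ≤ 1) (hy : ∀ t ∈ Icc 0 τ, y t ∈ Icc (0:ℝ) 1)
    (hd : ∀ t ∈ Icc 0 τ, HasDerivWithinAt y ((u (t, y t)).2 / (u (t, y t)).1) (Icc 0 τ) t) :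
    ∃ x : ℝ → ℝ, StrictMono x ∧ Function.Surjective x ∧ x 0 = 0 ∧
      ∀ t ∈ x ⁻¹' Icc 0 τ,
        HasDerivWithinAt (fun t => (x t, y (x t))) (u (x t, y (x t))) (x ⁻¹' Icc 0 τ) t := by
  have hyc : ContinuousOn y (Icc 0 τ) := fun t ht => (hd t ht).continuousWithinAt
  set r : ℝ → ℝ := fun t => max 0 (min τ t) with hr
  have hrm : ∀ t, r t ∈ Icc 0 τ := fun t => by simp [hr, hτ0]
  have hrid : ∀ t ∈ Icc 0 τ, r t = t := fun t ht => by simp [hr, ht.1, ht.2]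
  have hmem : ∀ t ∈ Icc 0 τ, (t, y t) ∈ Icc (0:ℝ) 1 ×ˢ Icc (0:ℝ) 1 :=
    fun t ht => ⟨⟨ht.1, ht.2.trans hτ1⟩, hy t ht⟩
  have hrc : Continuous r := by fun_prop
  have hyr : Continuous (fun t => y (r t)) := hyc.comp_continuous hrc hrm
  have hur : Continuous (fun t => (u (r t, y (r t))).1) :=
    (hu.comp_continuous (hrc.prodMk hyr) (fun t => hmem _ (hrm t))).fst
  have hpos : ∀ t, 0 < (u (r t, y (r t))).1 := fun t => hu1 _ (hmem _ (hrm t))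
  obtain ⟨C, hC⟩ := ((isCompact_Icc.prod isCompact_Icc).image_of_continuousOn
    (continuous_fst.comp_continuousOn hu)).bddAbove
  have hCb : ∀ t, (u (r t, y (r t))).1 ≤ C := fun t => hC ⟨_, hmem _ (hrm t), rfl⟩
  have hC0 : 0 < C := (hpos 0).trans_le (hCb 0)
  set q : ℝ → ℝ := fun t => ((u (r t, y (r t))).1)⁻¹ with hq
  have hqc : Continuous q := hur.inv₀ (fun t => (hpos t).ne')
  have hqpos : ∀ t, 0 < q t := fun t => inv_pos.2 (hpos t)
  set h : ℝ → ℝ := fun x => ∫ t in (0:ℝ)..x, q t with hh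
  have hder : ∀ x, HasDerivAt h (q x) x := fun x => (hqc.integral_hasStrictDerivAt 0 x).hasDerivAt
  have hmono : StrictMono h := strictMono_of_hasDerivAt_pos hder hqpos
  have hcont : Continuous h := continuous_iff_continuousAt.2 fun x => (hder x).continuousAt
  have hh0 : h 0 = 0 := by simp [hh]
  have hm2 : Monotone (fun x => h x - C⁻¹ * x) := by
    apply monotone_of_hasDerivAt_nonneg (f' := fun x => q x - C⁻¹ * 1)
    · intro x
      exact (hder x).sub ((hasDerivAt_id x).const_mul _)
    · intro x
      have : C⁻¹ ≤ q x := inv_anti₀ (hpos x) (hCb x)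
      simpa using this
  have hCi : 0 < C⁻¹ := inv_pos.2 hC0
  have hsurj : Function.Surjective h := by
    apply hcont.surjective
    · refine tendsto_atTop_mono' _ ?_ ((tendsto_id (α := ℝ)).const_mul_atTop hCi)
      filter_upwards [eventually_ge_atTop 0] with x hx
      have := hm2 hx
      simp only [hh0] at this
      simp only [id]; linarith
    · refine tendsto_atBot_mono' _ ?_ ((tendsto_id (α := ℝ)).const_mul_atBot hCi)
      filter_upwards [eventually_le_atBot 0] with x hx
      have := hm2 hx
      simp only [hh0] at this
      simp only [id]; linarith
  let e := hmono.orderIsoOfSurjective h hsurj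
  have he : ∀ t, h (e.symm t) = t := fun t => e.apply_symm_apply t
  refine ⟨e.symm, e.symm.strictMono, e.symm.surjective, ?_, ?_⟩
  · apply hmono.injective
    rw [he, hh0]
  · intro t ht
    have hxd : HasDerivAt e.symm (q (e.symm t))⁻¹ t :=
      HasDerivAt.of_local_left_inverse e.symm.continuous.continuousAt (hder _)
        (hqpos _).ne' (Eventually.of_forall he)
    have ht' : e.symm t ∈ Icc 0 τ := ht
    have hxd' : HasDerivAt e.symm (u (e.symm t, y (e.symm t))).1 t := by
      have : (q (e.symm t))⁻¹ = (u (e.symm t, y (e.symm t))).1 := by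
        simp only [hq, inv_inv, hrid _ ht']
      rwa [this] at hxd
    have hyd := HasDerivWithinAt.scomp (g₁ := y) t (hd _ ht') hxd'.hasDerivWithinAt
      (mapsTo_preimage (e.symm) (Icc 0 τ))
    have := hxd'.hasDerivWithinAt.prodMk hyd
    have hne := (hu1 _ (hmem _ ht')).ne'
    rw [smul_eq_mul, mul_div_cancel₀ _ hne] at this
    exact this

/-- slope of the field, extended by clamping -/
noncomputable def slopeQ (u : ℝ × ℝ → ℝ × ℝ) (p : ℝ × ℝ) : ℝ :=
  (u (clampQ p)).2 / (u (clampQ p)).1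

lemma slopeQ_clamp (u : ℝ × ℝ → ℝ × ℝ) (p : ℝ × ℝ) : slopeQ u (clampQ p) = slopeQ u p := by
  simp only [slopeQ, clampQ_of_mem (clampQ_mem p)]

lemma slopeQ_uc {u : ℝ × ℝ → ℝ × ℝ} (hu : ContinuousOn u (Icc (0:ℝ) 1 ×ˢ Icc (0:ℝ) 1))
    (hu1 : ∀ x ∈ Icc (0:ℝ) 1 ×ˢ Icc (0:ℝ) 1, 0 < (u x).1) :
    UniformContinuous (slopeQ u) ∧ ∃ M, ∀ p, |slopeQ u p| ≤ M := by
  have hc : ContinuousOn (fun p => (u p).2 / (u p).1) (Icc (0:ℝ) 1 ×ˢ Icc (0:ℝ) 1) :=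
    (continuous_snd.comp_continuousOn hu).div (continuous_fst.comp_continuousOn hu)
      (fun x hx => (hu1 x hx).ne')
  have hK : IsCompact (Icc (0:ℝ) 1 ×ˢ Icc (0:ℝ) 1) := isCompact_Icc.prod isCompact_Icc
  constructor
  · have h1 := hK.uniformContinuousOn_of_continuous hc
    rw [Metric.uniformContinuousOn_iff] at h1
    rw [Metric.uniformContinuous_iff]
    intro ε hε
    obtain ⟨δ, hδ, h⟩ := h1 ε hε
    refine ⟨δ, hδ, fun a b hab => h _ (clampQ_mem a) _ (clampQ_mem b) ?_⟩
    have := clampQ_lip.dist_le_mul a b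
    simp only [NNReal.coe_one, one_mul] at this
    exact this.trans_lt hab
  · obtain ⟨M, hM⟩ := hK.exists_bound_of_continuousOn hc
    exact ⟨M, fun p => hM _ (clampQ_mem p)⟩

lemma slopeQ_zero {u : ℝ × ℝ → ℝ × ℝ}
    (hu2 : ∀ x ∈ Icc (0:ℝ) 1 ×ˢ Icc (0:ℝ) 1, (x.2 = 0 ∨ x.2 = 1) → (u x).2 = 0)
    {p : ℝ × ℝ} (hp : p.2 ≤ 0 ∨ 1 ≤ p.2) : slopeQ u p = 0 := by
  have : (u (clampQ p)).2 = 0 := by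
    apply hu2 _ (clampQ_mem p)
    rcases hp with h | h
    · left; simp [clampQ, h]
    · right; simp [clampQ, h]
  simp [slopeQ, this]

lemma good_approx {u : ℝ × ℝ → ℝ × ℝ} (hu : ContinuousOn u (Icc (0:ℝ) 1 ×ˢ Icc (0:ℝ) 1))
    (hu1 : ∀ x ∈ Icc (0:ℝ) 1 ×ˢ Icc (0:ℝ) 1, 0 < (u x).1)
    (hu2 : ∀ x ∈ Icc (0:ℝ) 1 ×ˢ Icc (0:ℝ) 1, (x.2 = 0 ∨ x.2 = 1) → (u x).2 = 0)
    (hint : UniquelyIntegrableOn u (Icc (0:ℝ) 1 ×ˢ Icc (0:ℝ) 1)) {η : ℝ} (hη : 0 < η) :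
    ∃ (K : NNReal) (F : ℝ × ℝ → ℝ), LipschitzWith K F ∧
      (∀ p, slopeQ u p < F p ∧ F p < slopeQ u p + η) ∧
      ∀ y : ℝ → ℝ, y 0 = 0 → (∀ t ∈ Icc (0:ℝ) 1, HasDerivAt y (F (t, y t)) t) → y 1 < 1 := by
  obtain ⟨huc, M, hM⟩ := slopeQ_uc hu hu1
  by_contra hcon
  push Not at hcon
  have hex : ∀ n : ℕ, ∃ (F : ℝ × ℝ → ℝ) (y : ℝ → ℝ),
      (∀ p, slopeQ u p < F p ∧ F p < slopeQ u p + η ∧ F p < slopeQ u p + 1 / ((n:ℝ) + 1)) ∧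
      y 0 = 0 ∧ (∀ t ∈ Icc (0:ℝ) 1, HasDerivAt y (F (t, y t)) t) ∧ 1 ≤ y 1 := by
    intro n
    have hn : (0:ℝ) < 1 / ((n:ℝ) + 1) := by positivity
    obtain ⟨K, F, hF, hFb⟩ := lip_approx huc hM (lt_min hη hn)
    obtain ⟨y, h0, h1, h2⟩ := hcon K F hF (fun p => ⟨(hFb p).1,
      (hFb p).2.trans_le (by gcongr; exact min_le_left _ _)⟩)
    exact ⟨F, y, fun p => ⟨(hFb p).1, (hFb p).2.trans_le (by gcongr; exact min_le_left _ _),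
      (hFb p).2.trans_le (by gcongr; exact min_le_right _ _)⟩, h0, h1, h2⟩
  choose F y hF hy0 hyd hy1 using hex
  obtain ⟨z, U, hU, hlim, hzd⟩ := limit_curve (f := slopeQ u) (M := M + η) huc.continuous
    (y := y) (d := fun n t => F n (t, y n t)) hy0 hyd
    (fun n t _ => by
      have h1 := hF n (t, y n t)
      have h2 := abs_le.1 (hM (t, y n t))
      rw [abs_le]; constructor <;> linarith)
    (fun n t _ => by
      have h1 := hF n (t, y n t)
      rw [abs_le]; constructor <;> linarith)
  have hz0 : z 0 = 0 := by
    have := hlim 0 (by simp)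
    simp only [hy0] at this
    exact tendsto_nhds_unique this tendsto_const_nhds
  have hz1 : 1 ≤ z 1 := ge_of_tendsto' (hlim 1 (by simp)) hy1
  have hznn : ∀ t ∈ Icc (0:ℝ) 1, 0 ≤ z t := by
    intro t ht
    refine ge_of_tendsto' (hlim t ht) fun n => ?_
    rcases ht.1.eq_or_lt with h | h
    · rw [← h, hy0]
    · refine (persist (hyd n) (c := 0) (hy0 n).ge ?_ t ⟨h, ht.2⟩).le
      intro s _ hs
      have := (hF n (s, y n s)).1
      rwa [slopeQ_zero hu2 (by simp [hs])] at this
  have hzc : ContinuousOn z (Icc 0 1) := fun t ht => (hzd t ht).continuousWithinAt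
  -- first hitting time
  obtain ⟨τ, ⟨hτm, hτ1⟩, hτmin⟩ : ∃ τ, IsLeast (Icc (0:ℝ) 1 ∩ z ⁻¹' Ici 1) τ := by
    have hcl : IsCompact (Icc (0:ℝ) 1 ∩ z ⁻¹' Ici 1) :=
      isCompact_Icc.of_isClosed_subset (hzc.preimage_isClosed_of_isClosed isClosed_Icc isClosed_Ici)
        inter_subset_left
    exact hcl.exists_isLeast ⟨1, by simp, hz1⟩
  have hlt : ∀ t ∈ Icc 0 τ, t < τ → z t < 1 := by
    intro t ht htτ
    by_contra hc
    push Not at hc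
    exact absurd (hτmin ⟨⟨ht.1, ht.2.trans hτm.2⟩, hc⟩) (not_le.2 htτ)
  have hle : ∀ t ∈ Icc 0 τ, z t ≤ 1 := by
    have hτpos : (0:ℝ) ≠ τ := by
      rintro rfl
      have : (1:ℝ) ≤ z 0 := hτ1
      linarith
    have hcl : IsClosed (Icc 0 τ ∩ z ⁻¹' Iic 1) :=
      (hzc.mono (Icc_subset_Icc_right hτm.2)).preimage_isClosed_of_isClosed isClosed_Icc isClosed_Iic
    have hsub : Ico 0 τ ⊆ Icc 0 τ ∩ z ⁻¹' Iic 1 := fun t ht =>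
      ⟨⟨ht.1, ht.2.le⟩, (hlt t ⟨ht.1, ht.2.le⟩ ht.2).le⟩
    have := closure_minimal hsub hcl
    rw [closure_Ico hτpos] at this
    exact fun t ht => (this ht).2
  have hzI : ∀ t ∈ Icc 0 τ, z t ∈ Icc (0:ℝ) 1 := fun t ht =>
    ⟨hznn t ⟨ht.1, ht.2.trans hτm.2⟩, hle t ht⟩
  have hsl : ∀ p ∈ Icc (0:ℝ) 1 ×ˢ Icc (0:ℝ) 1, slopeQ u p = (u p).2 / (u p).1 := by
    intro p hp
    simp only [slopeQ, clampQ_of_mem hp]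
  obtain ⟨x₁, hx₁m, hx₁s, hx₁0, hx₁d⟩ := time_change hu hu1 hτm.1 hτm.2 hzI (fun t ht => by
    have ht' : t ∈ Icc (0:ℝ) 1 := ⟨ht.1, ht.2.trans hτm.2⟩
    rw [← hsl (t, z t) ⟨ht', hzI t ht⟩]
    exact (hzd t ht').mono (Icc_subset_Icc_right hτm.2))
  obtain ⟨x₂, hx₂m, hx₂s, hx₂0, hx₂d⟩ := time_change (y := fun _ => 0) hu hu1 zero_le_one le_rfl
    (fun _ _ => by simp) (fun t ht => by
      rw [hu2 (t, 0) ⟨ht, by simp⟩ (by simp), zero_div]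
      exact hasDerivWithinAt_const _ _ _)
  have huniq := hint (fun t => (x₁ t, z (x₁ t))) (fun t => (x₂ t, 0)) _ _
    (ordConnected_Icc.preimage_mono hx₁m.monotone)
    (ordConnected_Icc.preimage_mono hx₂m.monotone)
    (fun t ht => ⟨⟨ht.1, ht.2.trans hτm.2⟩, hzI _ ht⟩) hx₁d
    (fun t ht => ⟨ht, by simp⟩) hx₂d 0 (by simp [hx₁0, hx₂0, hτm.1]) (by simp [hx₁0, hx₂0, hz0])
  obtain ⟨t₁, ht₁⟩ := hx₁s τ
  obtain ⟨t₂, ht₂⟩ := hx₂s 1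
  have ht₁0 : 0 ≤ t₁ := by rw [← hx₁m.le_iff_le, hx₁0, ht₁]; exact hτm.1
  have ht₂0 : 0 ≤ t₂ := by rw [← hx₂m.le_iff_le, hx₂0, ht₂]; exact zero_le_one
  rcases le_or_gt t₁ t₂ with h | h
  · have h1 := huniq t₁ ⟨by simp [ht₁, hτm.1], by
      refine ⟨?_, ?_⟩
      · rw [← hx₂0]; exact hx₂m.monotone ht₁0
      · rw [← ht₂]; exact hx₂m.monotone h⟩
    have h2 := congrArg Prod.snd h1
    simp only [ht₁] at h2
    have : (1:ℝ) ≤ z τ := hτ1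
    linarith
  · have h1 := huniq t₂ ⟨by
      refine ⟨?_, ?_⟩
      · rw [← hx₁0]; exact hx₁m.monotone ht₂0
      · rw [← ht₁]; exact hx₁m.monotone h.le, by simp [ht₂]⟩
    have h2 := congrArg Prod.fst h1
    simp only [ht₂] at h2
    have h3 := hx₁m h
    rw [h2, ht₁] at h3
    linarith [hτm.2]

/-- the switch -/
noncomputable def lamQ (s t : ℝ) : ℝ := max 0 (min 1 (t - s))

lemma lamQ_mem (s t : ℝ) : lamQ s t ∈ Icc (0:ℝ) 1 := by simp [lamQ]

lemma lamQ_lip (s s' t : ℝ) : |lamQ s t - lamQ s' t| ≤ |s - s'| := by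
  have h1 : LipschitzWith 1 (fun s : ℝ => t - s) :=
    LipschitzWith.of_dist_le_mul fun a b => by
      have e : (t - a) - (t - b) = -(a - b) := by ring
      rw [Real.dist_eq, Real.dist_eq, NNReal.coe_one, one_mul, e, abs_neg]
  have h : LipschitzWith 1 (fun s : ℝ => max 0 (min 1 (t - s))) :=
    (h1.const_min 1).const_max 0
  have := h.dist_le_mul s s'
  rw [Real.dist_eq, Real.dist_eq, NNReal.coe_one, one_mul] at this
  exact this

/-- switched field -/
noncomputable def fieldQ (F G : ℝ × ℝ → ℝ) (l : ℝ) (p : ℝ × ℝ) : ℝ × ℝ :=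
  ((1 - l) + l * G p, (1 - l) * F p + l)

lemma fieldQ_lip {F G : ℝ × ℝ → ℝ} {K : NNReal} (hF : LipschitzWith K F) (hG : LipschitzWith K G)
    {l : ℝ} (hl : l ∈ Icc (0:ℝ) 1) : LipschitzWith K (fieldQ F G l) := by
  apply LipschitzWith.of_dist_le_mul
  intro p q
  have h1 := hF.dist_le_mul p q
  have h2 := hG.dist_le_mul p q
  rw [Real.dist_eq] at h1 h2
  rw [Prod.dist_eq, Real.dist_eq, Real.dist_eq]
  apply max_le
  · have : (fieldQ F G l p).1 - (fieldQ F G l q).1 = l * (G p - G q) := by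
      simp only [fieldQ]; ring
    rw [this, abs_mul, abs_of_nonneg hl.1]
    nlinarith [abs_nonneg (G p - G q), hl.2]
  · have : (fieldQ F G l p).2 - (fieldQ F G l q).2 = (1 - l) * (F p - F q) := by
      simp only [fieldQ]; ring
    rw [this, abs_mul, abs_of_nonneg (by linarith [hl.2])]
    nlinarith [abs_nonneg (F p - F q), hl.1]

lemma fieldQ_diff {F G : ℝ × ℝ → ℝ} {M : ℝ} (hF : ∀ p, |F p| ≤ M) (hG : ∀ p, |G p| ≤ M)
    (l l' : ℝ) (p : ℝ × ℝ) : dist (fieldQ F G l p) (fieldQ F G l' p) ≤ (1 + M) * |l - l'| := by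
  rw [Prod.dist_eq, Real.dist_eq, Real.dist_eq]
  apply max_le
  · have : (fieldQ F G l p).1 - (fieldQ F G l' p).1 = (G p - 1) * (l - l') := by
      simp only [fieldQ]; ring
    rw [this, abs_mul]
    gcongr
    have := abs_le.1 (hG p)
    rw [abs_le]; constructor <;> linarith
  · have : (fieldQ F G l p).2 - (fieldQ F G l' p).2 = (1 - F p) * (l - l') := by
      simp only [fieldQ]; ring
    rw [this, abs_mul]
    gcongr
    have := abs_le.1 (hF p)
    rw [abs_le]; constructor <;> linarith

lemma fieldQ_norm {F G : ℝ × ℝ → ℝ} {M : ℝ} (hF : ∀ p, |F p| ≤ M) (hG : ∀ p, |G p| ≤ M)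
    {l : ℝ} (hl : l ∈ Icc (0:ℝ) 1) (p : ℝ × ℝ) : ‖fieldQ F G l p‖ ≤ 1 + M := by
  have h1 := abs_le.1 (hG p)
  have h2 := abs_le.1 (hF p)
  obtain ⟨l0, l1⟩ := hl
  rw [Prod.norm_def, Real.norm_eq_abs, Real.norm_eq_abs]
  apply max_le
  · simp only [fieldQ]
    rw [abs_le]; constructor <;> nlinarith
  · simp only [fieldQ]
    rw [abs_le]; constructor <;> nlinarith

lemma fieldQ_sol {F G : ℝ × ℝ → ℝ} {K : NNReal} (hF : LipschitzWith K F) (hG : LipschitzWith K G)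
    {M : ℝ} (hFM : ∀ p, |F p| ≤ M) (hGM : ∀ p, |G p| ≤ M) (s : ℝ) :
    ∃ z : ℝ → ℝ × ℝ, z 0 = 0 ∧
      ∀ t ∈ Icc (0:ℝ) 4, HasDerivAt z (fieldQ F G (lamQ s t) (z t)) t := by
  have hM0 : 0 ≤ M := (abs_nonneg _).trans (hFM 0)
  let L : NNReal := ⟨1 + M, by positivity⟩
  have hL : (L : ℝ) = 1 + M := rfl
  have hPL : IsPicardLindelof (tmin := -1) (tmax := 5) (fun t p => fieldQ F G (lamQ s t) p)
      ⟨0, by norm_num⟩ 0 (L * 5) 0 L K := by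
    constructor
    · intro t _
      exact (fieldQ_lip hF hG (lamQ_mem s t)).lipschitzOnWith
    · intro p _
      have : Continuous (fun t => lamQ s t) := by unfold lamQ; fun_prop
      simp only [fieldQ]
      fun_prop
    · intro t _ p _
      exact fieldQ_norm hFM hGM (lamQ_mem s t) p
    · simp
  obtain ⟨z, h0, h⟩ := hPL.exists_eq_forall_mem_Icc_hasDerivWithinAt₀
  refine ⟨z, h0, fun t ht => ?_⟩
  exact (h t ⟨by linarith [ht.1], by linarith [ht.2]⟩).hasDerivAt
    (Icc_mem_nhds (by linarith [ht.1]) (by linarith [ht.2]))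

lemma fieldQ_cont {F G : ℝ × ℝ → ℝ} {K : NNReal} (hF : LipschitzWith K F)
    (hG : LipschitzWith K G) {M : ℝ} (hFM : ∀ p, |F p| ≤ M) (hGM : ∀ p, |G p| ≤ M)
    {z : ℝ → ℝ → ℝ × ℝ} (h0 : ∀ s, z s 0 = 0)
    (hd : ∀ s, ∀ t ∈ Icc (0:ℝ) 4, HasDerivAt (z s) (fieldQ F G (lamQ s t) (z s t)) t)
    {t : ℝ} (ht : t ∈ Icc (0:ℝ) 4) : Continuous (fun s => z s t) := by
  rw [continuous_iff_continuousAt]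
  intro s₀
  rw [ContinuousAt, tendsto_iff_dist_tendsto_zero]
  have hM0 : 0 ≤ M := (abs_nonneg _).trans (hFM 0)
  have hb : ∀ s, dist (z s t) (z s₀ t) ≤ gronwallBound 0 K ((1 + M) * |s - s₀| + 0) (t - 0) := by
    intro s
    refine dist_le_of_approx_trajectories_ODE (v := fun t p => fieldQ F G (lamQ s₀ t) p)
      (a := 0) (b := 4) (fun t => fieldQ_lip hF hG (lamQ_mem s₀ t))
      (fun t ht => (hd s t ht).continuousAt.continuousWithinAt)
      (fun t ht => (hd s t ⟨ht.1, ht.2.le⟩).hasDerivWithinAt) ?_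
      (fun t ht => (hd s₀ t ht).continuousAt.continuousWithinAt)
      (fun t ht => (hd s₀ t ⟨ht.1, ht.2.le⟩).hasDerivWithinAt) (fun t _ => by simp)
      (by simp [h0]) t ht
    intro t _
    refine (fieldQ_diff hFM hGM _ _ _).trans ?_
    exact mul_le_mul_of_nonneg_left (lamQ_lip _ _ _) (by positivity)
  refine squeeze_zero (fun _ => dist_nonneg) hb ?_
  have hc : Continuous (fun s => gronwallBound 0 K ((1 + M) * |s - s₀| + 0) (t - 0)) :=
    (gronwallBound_continuous_ε 0 K (t - 0)).comp (by fun_prop)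
  have := hc.tendsto s₀
  simpa [gronwallBound_ε0_δ0] using this

lemma core {F G : ℝ × ℝ → ℝ} {K : NNReal} (hF : LipschitzWith K F)
    (hG : LipschitzWith K G) {M : ℝ} (hFM : ∀ p, |F p| ≤ M) (hGM : ∀ p, |G p| ≤ M)
    (hFp : ∀ p : ℝ × ℝ, (p.2 ≤ 0 ∨ 1 ≤ p.2) → 0 < F p)
    (hGp : ∀ p : ℝ × ℝ, (p.1 ≤ 0 ∨ 1 ≤ p.1) → 0 < G p)
    (hFy : ∀ y : ℝ → ℝ, y 0 = 0 → (∀ t ∈ Icc (0:ℝ) 1, HasDerivAt y (F (t, y t)) t) → y 1 < 1)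
    (hGx : ∀ x : ℝ → ℝ, x 0 = 0 → (∀ t ∈ Icc (0:ℝ) 1, HasDerivAt x (G (x t, t)) t) → x 1 < 1) :
    ∃ (z : ℝ → ℝ × ℝ) (s T : ℝ), 0 < T ∧ z 0 = 0 ∧ z T = (1, 1) ∧
      ∀ t ∈ Icc (0:ℝ) T, z t ∈ Icc (0:ℝ) 1 ×ˢ Icc (0:ℝ) 1 ∧
        HasDerivAt z (fieldQ F G (lamQ s t) (z t)) t := by
  choose z h0 hd using fieldQ_sol hF hG hFM hGM
  have hcs : ∀ t ∈ Icc (0:ℝ) 4, Continuous (fun s => z s t) := fun t ht =>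
    fieldQ_cont hF hG hFM hGM h0 hd ht
  have hd1 : ∀ s, ∀ t ∈ Icc (0:ℝ) 4,
      HasDerivAt (fun t => (z s t).1) (fieldQ F G (lamQ s t) (z s t)).1 t :=
    fun s t ht => (ContinuousLinearMap.fst ℝ ℝ ℝ).hasFDerivAt.comp_hasDerivAt t (hd s t ht)
  have hd2 : ∀ s, ∀ t ∈ Icc (0:ℝ) 4,
      HasDerivAt (fun t => (z s t).2) (fieldQ F G (lamQ s t) (z s t)).2 t :=
    fun s t ht => (ContinuousLinearMap.snd ℝ ℝ ℝ).hasFDerivAt.comp_hasDerivAt t (hd s t ht)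
  have hf1 : ∀ l ∈ Icc (0:ℝ) 1, ∀ p : ℝ × ℝ, (p.1 ≤ 0 ∨ 1 ≤ p.1) → 0 < (fieldQ F G l p).1 := by
    intro l hl p hp
    have := hGp p hp
    simp only [fieldQ]
    rcases hl.1.eq_or_lt with h | h
    · rw [← h]; norm_num
    · have := mul_pos h this
      linarith [hl.2]
  have hf2 : ∀ l ∈ Icc (0:ℝ) 1, ∀ p : ℝ × ℝ, (p.2 ≤ 0 ∨ 1 ≤ p.2) → 0 < (fieldQ F G l p).2 := by
    intro l hl p hp
    have := hFp p hp
    simp only [fieldQ]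
    rcases hl.2.eq_or_lt with h | h
    · rw [h]; norm_num
    · have := mul_pos (sub_pos.2 h) this
      linarith [hl.1]
  -- persistence of barriers
  have p1 : ∀ s a, 0 ≤ a → ∀ c, (c = 0 ∨ c = 1) → c ≤ (z s a).1 →
      ∀ t ∈ Ioc a 4, c < (z s t).1 := by
    intro s a ha c hc hle
    have hs : ∀ t ∈ Icc a 4, t ∈ Icc (0:ℝ) 4 := fun t ht => ⟨ha.trans ht.1, ht.2⟩
    refine persist (fun t ht => hd1 s t (hs t ht)) hle (fun t _ heq => hf1 _ (lamQ_mem s t) _ ?_)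
    rcases hc with h | h
    · left; linarith
    · right; linarith
  have p2 : ∀ s a, 0 ≤ a → ∀ c, (c = 0 ∨ c = 1) → c ≤ (z s a).2 →
      ∀ t ∈ Ioc a 4, c < (z s t).2 := by
    intro s a ha c hc hle
    have hs : ∀ t ∈ Icc a 4, t ∈ Icc (0:ℝ) 4 := fun t ht => ⟨ha.trans ht.1, ht.2⟩
    refine persist (fun t ht => hd2 s t (hs t ht)) hle (fun t _ heq => hf2 _ (lamQ_mem s t) _ ?_)
    rcases hc with h | h
    · left; linarith
    · right; linarith
  have nn1 : ∀ s, ∀ t ∈ Icc (0:ℝ) 4, 0 ≤ (z s t).1 := by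
    intro s t ht
    rcases ht.1.eq_or_lt with h | h
    · rw [← h, h0]; simp
    · exact (p1 s 0 le_rfl 0 (Or.inl rfl) (by simp [h0]) t ⟨h, ht.2⟩).le
  have nn2 : ∀ s, ∀ t ∈ Icc (0:ℝ) 4, 0 ≤ (z s t).2 := by
    intro s t ht
    rcases ht.1.eq_or_lt with h | h
    · rw [← h, h0]; simp
    · exact (p2 s 0 le_rfl 0 (Or.inl rfl) (by simp [h0]) t ⟨h, ht.2⟩).le
  have c1 : ∀ s, ∀ t ∈ Icc (0:ℝ) 4, ContinuousAt (fun t => (z s t).1) t :=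
    fun s t ht => (hd1 s t ht).continuousAt
  have c2 : ∀ s, ∀ t ∈ Icc (0:ℝ) 4, ContinuousAt (fun t => (z s t).2) t :=
    fun s t ht => (hd2 s t ht).continuousAt
  let A : Set ℝ := {s | ∃ t ∈ Icc (0:ℝ) 4, 1 < (z s t).1 ∧ (z s t).2 < 1}
  let B : Set ℝ := {s | ∃ t ∈ Icc (0:ℝ) 4, (z s t).1 < 1 ∧ 1 < (z s t).2}
  have hA : IsOpen A := by
    have : A = ⋃ t ∈ Icc (0:ℝ) 4, {s | 1 < (z s t).1 ∧ (z s t).2 < 1} := by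
      ext s; simp only [A, mem_ofPred_eq, mem_iUnion, exists_prop]
    rw [this]
    exact isOpen_biUnion fun t ht =>
      (isOpen_lt continuous_const (hcs t ht).fst).inter (isOpen_lt (hcs t ht).snd continuous_const)
  have hB : IsOpen B := by
    have : B = ⋃ t ∈ Icc (0:ℝ) 4, {s | (z s t).1 < 1 ∧ 1 < (z s t).2} := by
      ext s; simp only [B, mem_ofPred_eq, mem_iUnion, exists_prop]
    rw [this]
    exact isOpen_biUnion fun t ht =>
      (isOpen_lt (hcs t ht).fst continuous_const).inter (isOpen_lt continuous_const (hcs t ht).snd)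
  have hAB : A ∩ B = ∅ := by
    rw [eq_empty_iff_forall_notMem]
    rintro s ⟨⟨t, ht, h1, h2⟩, t', ht', h3, h4⟩
    rcases lt_trichotomy t t' with h | h | h
    · linarith [p1 s t ht.1 1 (Or.inr rfl) h1.le t' ⟨h, ht'.2⟩]
    · subst h; linarith
    · linarith [p2 s t' ht'.1 1 (Or.inr rfl) h4.le t ⟨h, ht.2⟩]
  have h14 : (1:ℝ) ∈ Icc (0:ℝ) 4 := by norm_num
  have lin : ∀ w : ℝ → ℝ, ∀ a b : ℝ, (∀ t ∈ Icc a b, HasDerivAt w 1 t) →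
      ∀ t ∈ Icc a b, w t = w a + (t - a) := by
    intro w a b hw t ht
    have := (convex_Icc a b).norm_image_sub_le_of_norm_hasDerivWithin_le
      (f := fun t => w t - t) (f' := fun _ => (1:ℝ) - 1) (C := 0)
      (fun t ht => ((hw t ht).sub (hasDerivAt_id t)).hasDerivWithinAt) (by simp)
      (left_mem_Icc.2 (ht.1.trans ht.2)) ht
    rw [zero_mul, norm_le_zero_iff] at this
    linarith
  have hA1 : (1:ℝ) ∈ A := by
    have hl : ∀ t ∈ Icc (0:ℝ) 1, lamQ 1 t = 0 := fun t ht => by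
      simp only [lamQ, max_eq_left_iff, min_le_iff]; right; linarith [ht.2]
    have sub : ∀ t ∈ Icc (0:ℝ) 1, t ∈ Icc (0:ℝ) 4 := fun t ht => ⟨ht.1, by linarith [ht.2]⟩
    have hx : ∀ t ∈ Icc (0:ℝ) 1, (z 1 t).1 = t := by
      intro t ht
      have := lin (fun t => (z 1 t).1) 0 1 (fun t ht => by
        have := hd1 1 t (sub t ht)
        simpa [hl t ht, fieldQ] using this) t ht
      simpa [h0] using this
    have hy : (z 1 1).2 < 1 := by
      apply hFy (fun t => (z 1 t).2) (by simp [h0])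
      intro t ht
      have h := hd2 1 t (sub t ht)
      have e : z 1 t = (t, (z 1 t).2) := Prod.ext (hx t ht) rfl
      rw [hl t ht] at h
      rw [← e]
      simpa [fieldQ] using h
    have e1 : ∀ᶠ t in 𝓝[>] (1:ℝ), (z 1 t).2 < 1 :=
      mem_nhdsWithin_of_mem_nhds ((c2 1 1 h14).eventually (gt_mem_nhds hy))
    have e2 : ∀ᶠ t in 𝓝[>] (1:ℝ), t ∈ Ioo (1:ℝ) 4 := Ioo_mem_nhdsGT (by norm_num)
    obtain ⟨t, h1, h2⟩ := (e1.and e2).exists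
    exact ⟨t, ⟨by linarith [h2.1], h2.2.le⟩, p1 1 1 zero_le_one 1 (Or.inr rfl)
      (by rw [hx 1 (by simp)]) t ⟨h2.1, h2.2.le⟩, h1⟩
  have hB1 : (-1:ℝ) ∈ B := by
    have hl : ∀ t ∈ Icc (0:ℝ) 1, lamQ (-1) t = 1 := fun t ht => by
      have : min 1 (t - -1) = 1 := min_eq_left (by linarith [ht.1])
      rw [lamQ, this]; simp
    have sub : ∀ t ∈ Icc (0:ℝ) 1, t ∈ Icc (0:ℝ) 4 := fun t ht => ⟨ht.1, by linarith [ht.2]⟩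
    have hx : ∀ t ∈ Icc (0:ℝ) 1, (z (-1) t).2 = t := by
      intro t ht
      have := lin (fun t => (z (-1) t).2) 0 1 (fun t ht => by
        have := hd2 (-1) t (sub t ht)
        simpa [hl t ht, fieldQ] using this) t ht
      simpa [h0] using this
    have hy : (z (-1) 1).1 < 1 := by
      apply hGx (fun t => (z (-1) t).1) (by simp [h0])
      intro t ht
      have h := hd1 (-1) t (sub t ht)
      have e : z (-1) t = ((z (-1) t).1, t) := Prod.ext rfl (hx t ht)
      rw [hl t ht] at h
      rw [← e]
      simpa [fieldQ] using h
    have e1 : ∀ᶠ t in 𝓝[>] (1:ℝ), (z (-1) t).1 < 1 :=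
      mem_nhdsWithin_of_mem_nhds ((c1 (-1) 1 h14).eventually (gt_mem_nhds hy))
    have e2 : ∀ᶠ t in 𝓝[>] (1:ℝ), t ∈ Ioo (1:ℝ) 4 := Ioo_mem_nhdsGT (by norm_num)
    obtain ⟨t, h1, h2⟩ := (e1.and e2).exists
    exact ⟨t, ⟨by linarith [h2.1], h2.2.le⟩, h1, p2 (-1) 1 zero_le_one 1 (Or.inr rfl)
      (by rw [hx 1 (by simp)]) t ⟨h2.1, h2.2.le⟩⟩
  obtain ⟨s, hs, hsA, hsB⟩ : ∃ s ∈ Icc (-1:ℝ) 1, s ∉ A ∧ s ∉ B := by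
    by_contra hc
    push Not at hc
    obtain ⟨s, _, hs⟩ := isPreconnected_Icc (a := (-1:ℝ)) (b := 1) A B hA hB
      (fun s hs => by
        by_cases h : s ∈ A
        · exact Or.inl h
        · exact Or.inr (hc s hs h))
      ⟨1, by norm_num, hA1⟩ ⟨-1, by norm_num, hB1⟩
    rw [hAB] at hs
    exact hs
  have hyend : 1 ≤ (z s 4).2 := by
    have hl : ∀ t ∈ Icc (2:ℝ) 4, lamQ s t = 1 := fun t ht => by
      have : min 1 (t - s) = 1 := min_eq_left (by linarith [ht.1, hs.2])
      simp [lamQ, this]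
    have sub : ∀ t ∈ Icc (2:ℝ) 4, t ∈ Icc (0:ℝ) 4 := fun t ht => ⟨by linarith [ht.1], ht.2⟩
    have := lin (fun t => (z s t).2) 2 4 (fun t ht => by
        have := hd2 s t (sub t ht)
        simpa [hl t ht, fieldQ] using this) 4 (by norm_num)
    have h2 := nn2 s 2 (by norm_num)
    linarith
  obtain ⟨T, hT, hyT⟩ : ∃ T ∈ Icc (0:ℝ) 4, (z s T).2 = 1 := by
    have := intermediate_value_Icc (a := (0:ℝ)) (b := 4) (f := fun t => (z s t).2) (by norm_num)
      (fun t ht => (c2 s t ht).continuousWithinAt)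
    exact this ⟨by simp [h0], hyend⟩
  have hT0 : 0 < T := by
    refine lt_of_le_of_ne hT.1 ?_
    rintro rfl
    simp [h0] at hyT
  have hylt : ∀ t ∈ Ico 0 T, (z s t).2 < 1 := by
    intro t ht
    by_contra hc
    push Not at hc
    linarith [p2 s t ht.1 1 (Or.inr rfl) hc T ⟨ht.2, hT.2⟩]
  have hxT1 : (z s T).1 ≤ 1 := by
    by_contra hc
    push Not at hc
    have e1 : ∀ᶠ t in 𝓝[<] T, 1 < (z s t).1 :=
      mem_nhdsWithin_of_mem_nhds ((c1 s T hT).eventually (lt_mem_nhds hc))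
    have e2 : ∀ᶠ t in 𝓝[<] T, t ∈ Ioo 0 T := Ioo_mem_nhdsLT hT0
    obtain ⟨t, h1, h2⟩ := (e1.and e2).exists
    exact hsA ⟨t, ⟨h2.1.le, h2.2.le.trans hT.2⟩, h1, hylt t ⟨h2.1.le, h2.2⟩⟩
  have hxT2 : 1 ≤ (z s T).1 := by
    by_contra hc
    push Not at hc
    rcases hT.2.eq_or_lt with h4 | h4
    · -- the terminal time is not the hitting time
      have hl : ∀ t ∈ Icc (2:ℝ) 4, lamQ s t = 1 := fun t ht => by
        have : min 1 (t - s) = 1 := min_eq_left (by linarith [ht.1, hs.2])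
        simp [lamQ, this]
      have sub : ∀ t ∈ Icc (2:ℝ) 4, t ∈ Icc (0:ℝ) 4 := fun t ht => ⟨by linarith [ht.1], ht.2⟩
      have := lin (fun t => (z s t).2) 2 4 (fun t ht => by
          have := hd2 s t (sub t ht)
          simpa [hl t ht, fieldQ] using this) 4 (by norm_num)
      have h2 := nn2 s 2 (by norm_num)
      rw [h4] at hyT
      linarith
    · have e1 : ∀ᶠ t in 𝓝[>] T, (z s t).1 < 1 :=
        mem_nhdsWithin_of_mem_nhds ((c1 s T hT).eventually (gt_mem_nhds hc))
      have e2 : ∀ᶠ t in 𝓝[>] T, t ∈ Ioo T 4 := Ioo_mem_nhdsGT h4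
      obtain ⟨t, h1, h2⟩ := (e1.and e2).exists
      exact hsB ⟨t, ⟨hT.1.trans h2.1.le, h2.2.le⟩, h1,
        p2 s T hT.1 1 (Or.inr rfl) hyT.ge t ⟨h2.1, h2.2.le⟩⟩
  refine ⟨z s, s, T, hT0, h0 s, Prod.ext (le_antisymm hxT1 hxT2) hyT, fun t ht => ?_⟩
  have ht4 : t ∈ Icc (0:ℝ) 4 := ⟨ht.1, ht.2.trans hT.2⟩
  refine ⟨⟨⟨nn1 s t ht4, ?_⟩, nn2 s t ht4, ?_⟩, hd s t ht4⟩
  · by_contra hc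
    push Not at hc
    rcases ht.2.eq_or_lt with h | h
    · rw [h] at hc; linarith
    · linarith [p1 s t ht.1 1 (Or.inr rfl) hc.le T ⟨h, hT.2⟩]
  · rcases ht.2.eq_or_lt with h | h
    · rw [h, hyT]
    · exact (hylt t ⟨ht.1, h⟩).le

lemma clampQ_swap (p : ℝ × ℝ) : clampQ p.swap = (clampQ p).swap := rfl

lemma swap_mem {p : ℝ × ℝ} (hp : p ∈ Icc (0:ℝ) 1 ×ˢ Icc (0:ℝ) 1) :
    p.swap ∈ Icc (0:ℝ) 1 ×ˢ Icc (0:ℝ) 1 := ⟨hp.2, hp.1⟩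

lemma swap_deriv {γ : ℝ → ℝ × ℝ} {d : ℝ × ℝ} {s : Set ℝ} {t : ℝ} (h : HasDerivWithinAt γ d s t) :
    HasDerivWithinAt (fun t => (γ t).swap) d.swap s t := by
  have h1 := (ContinuousLinearMap.fst ℝ ℝ ℝ).hasFDerivAt.comp_hasDerivWithinAt t h
  have h2 := (ContinuousLinearMap.snd ℝ ℝ ℝ).hasFDerivAt.comp_hasDerivWithinAt t h
  exact h2.prodMk h1

lemma swap_uniq {v : ℝ × ℝ → ℝ × ℝ}
    (h : UniquelyIntegrableOn v (Icc (0:ℝ) 1 ×ˢ Icc (0:ℝ) 1)) :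
    UniquelyIntegrableOn (fun p => (v p.swap).swap) (Icc (0:ℝ) 1 ×ˢ Icc (0:ℝ) 1) := by
  intro γ₁ γ₂ s₁ s₂ o₁ o₂ m₁ d₁ m₂ d₂ t₀ ht₀ heq t ht
  have := h (fun t => (γ₁ t).swap) (fun t => (γ₂ t).swap) s₁ s₂ o₁ o₂
    (fun t ht => swap_mem (m₁ t ht)) (fun t ht => by simpa using swap_deriv (d₁ t ht))
    (fun t ht => swap_mem (m₂ t ht)) (fun t ht => by simpa using swap_deriv (d₂ t ht))
    t₀ ht₀ (by simp [heq]) t ht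
  exact Prod.swap_injective this

lemma det_pos {u v : ℝ × ℝ → ℝ × ℝ} (hu : ContinuousOn u (Icc (0:ℝ) 1 ×ˢ Icc (0:ℝ) 1))
    (hv : ContinuousOn v (Icc (0:ℝ) 1 ×ˢ Icc (0:ℝ) 1))
    (hind : ∀ x ∈ Icc (0:ℝ) 1 ×ˢ Icc (0:ℝ) 1, LinearIndependent ℝ ![u x, v x])
    (hu1 : ∀ x ∈ Icc (0:ℝ) 1 ×ˢ Icc (0:ℝ) 1, 0 < (u x).1)
    (hv2 : ∀ x ∈ Icc (0:ℝ) 1 ×ˢ Icc (0:ℝ) 1, 0 < (v x).2)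
    (hu2 : ∀ x ∈ Icc (0:ℝ) 1 ×ˢ Icc (0:ℝ) 1, (x.2 = 0 ∨ x.2 = 1) → (u x).2 = 0) :
    ∀ p ∈ Icc (0:ℝ) 1 ×ˢ Icc (0:ℝ) 1, 0 < (u p).1 * (v p).2 - (u p).2 * (v p).1 := by
  have hne : ∀ p ∈ Icc (0:ℝ) 1 ×ˢ Icc (0:ℝ) 1, (u p).1 * (v p).2 - (u p).2 * (v p).1 ≠ 0 := by
    intro p hp h
    have h1 := (LinearIndependent.pair_iff.1 (hind p hp) (v p).2 (-(u p).2) (by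
      ext
      · simp; linarith
      · simp; ring)).1
    exact (hv2 p hp).ne' h1
  have hc : ContinuousOn (fun p => (u p).1 * (v p).2 - (u p).2 * (v p).1)
      (Icc (0:ℝ) 1 ×ˢ Icc (0:ℝ) 1) :=
    ((continuous_fst.comp_continuousOn hu).mul (continuous_snd.comp_continuousOn hv)).sub
      ((continuous_snd.comp_continuousOn hu).mul (continuous_fst.comp_continuousOn hv))
  have h0m : ((0:ℝ), (0:ℝ)) ∈ Icc (0:ℝ) 1 ×ˢ Icc (0:ℝ) 1 := by simp
  intro p hp
  by_contra hcon
  push Not at hcon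
  have := (isPreconnected_Icc.prod isPreconnected_Icc).intermediate_value hp h0m hc
  obtain ⟨q, hq, hq0⟩ := this (show (0:ℝ) ∈ _ from ⟨hcon, by
    have e := hu2 _ h0m (Or.inl rfl)
    have := mul_pos (hu1 _ h0m) (hv2 _ h0m)
    simp only [e]; linarith⟩)
  exact hne q hq hq0

/-- Lemma `lem:smooth diagonal`, vector-field formulation.
Let `Q = [0,1]²` and let `u, v : Q → ℝ²` be continuous vector fields that are
linearly independent at every point of `Q`, with the first coordinate of `u` and the
second coordinate of `v` strictly positive on `Q`, with `u` tangent to the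
horizontal boundary edges and `v` tangent to the vertical boundary edges, and both
uniquely integrable in `Q`.  Then there is a `C¹` curve `α : [0,1] → Q` from
`(0,0)` to `(1,1)` whose derivative at every time lies in the open positive cone
spanned by `u` and `v` at the corresponding point. -/
theorem exists_smooth_diagonal
    (u v : ℝ × ℝ → ℝ × ℝ)
    (Q : Set (ℝ × ℝ)) (hQ : Q = Set.Icc (0:ℝ) 1 ×ˢ Set.Icc (0:ℝ) 1)
    (hu : ContinuousOn u Q) (hv : ContinuousOn v Q)
    (hind : ∀ x ∈ Q, LinearIndependent ℝ ![u x, v x])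
    (hu1 : ∀ x ∈ Q, 0 < (u x).1)
    (hv2 : ∀ x ∈ Q, 0 < (v x).2)
    (hu2 : ∀ x ∈ Q, (x.2 = 0 ∨ x.2 = 1) → (u x).2 = 0)
    (hv1 : ∀ x ∈ Q, (x.1 = 0 ∨ x.1 = 1) → (v x).1 = 0)
    (huint : UniquelyIntegrableOn u Q)
    (hvint : UniquelyIntegrableOn v Q) :
    ∃ α α' : ℝ → ℝ × ℝ,
      (∀ t ∈ Set.Icc (0:ℝ) 1, α t ∈ Q) ∧
      α 0 = (0, 0) ∧ α 1 = (1, 1) ∧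
      ContinuousOn α' (Set.Icc (0:ℝ) 1) ∧
      (∀ t ∈ Set.Icc (0:ℝ) 1, HasDerivWithinAt α (α' t) (Set.Icc (0:ℝ) 1) t) ∧
      ∀ t ∈ Set.Icc (0:ℝ) 1, ∃ a b : ℝ, 0 < a ∧ 0 < b ∧
        α' t = a • u (α t) + b • v (α t) := by
  subst hQ
  set v' : ℝ × ℝ → ℝ × ℝ := fun p => (v p.swap).swap with hv'
  have hv'c : ContinuousOn v' (Set.Icc (0:ℝ) 1 ×ˢ Set.Icc (0:ℝ) 1) :=
    continuous_swap.comp_continuousOn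
      (hv.comp continuous_swap.continuousOn (fun p hp => swap_mem hp))
  have hv'1 : ∀ x ∈ Set.Icc (0:ℝ) 1 ×ˢ Set.Icc (0:ℝ) 1, 0 < (v' x).1 :=
    fun x hx => hv2 _ (swap_mem hx)
  have hv'2 : ∀ x ∈ Set.Icc (0:ℝ) 1 ×ˢ Set.Icc (0:ℝ) 1, (x.2 = 0 ∨ x.2 = 1) → (v' x).2 = 0 :=
    fun x hx h => hv1 _ (swap_mem hx) h
  have hdet := det_pos hu hv hind hu1 hv2 hu2
  obtain ⟨hfuc, Mf, hMf⟩ := slopeQ_uc hu hu1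
  obtain ⟨hguc, Mg, hMg⟩ := slopeQ_uc hv'c hv'1
  set f := slopeQ u with hf
  set g : ℝ × ℝ → ℝ := fun p => slopeQ v' p.swap with hg
  have hfQ : ∀ p ∈ Set.Icc (0:ℝ) 1 ×ˢ Set.Icc (0:ℝ) 1, f p = (u p).2 / (u p).1 := by
    intro p hp
    simp only [hf, slopeQ, clampQ_of_mem hp]
  have hgQ : ∀ p ∈ Set.Icc (0:ℝ) 1 ×ˢ Set.Icc (0:ℝ) 1, g p = (v p).1 / (v p).2 := by
    intro p hp
    simp only [hg, slopeQ, clampQ_of_mem (swap_mem hp), hv', Prod.swap_swap, Prod.snd_swap,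
      Prod.fst_swap]
  have hgM : ∀ p, |g p| ≤ Mg := fun p => hMg _
  have hfc : Continuous f := hfuc.continuous
  have hgc : Continuous g := hguc.continuous.comp continuous_swap
  obtain ⟨m, hm0, hm⟩ : ∃ m : ℝ, 0 < m ∧
      ∀ p ∈ Set.Icc (0:ℝ) 1 ×ˢ Set.Icc (0:ℝ) 1, m ≤ 1 - f p * g p := by
    have hK : IsCompact (Set.Icc (0:ℝ) 1 ×ˢ Set.Icc (0:ℝ) 1) := isCompact_Icc.prod isCompact_Icc
    obtain ⟨p, hp, hmin⟩ := hK.exists_isMinOn ⟨(0, 0), by simp⟩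
      (f := fun p => 1 - f p * g p) (by fun_prop)
    refine ⟨1 - f p * g p, ?_, fun q hq => hmin hq⟩
    have a := hu1 p hp
    have b := hv2 p hp
    have : 1 - f p * g p = ((u p).1 * (v p).2 - (u p).2 * (v p).1) / ((u p).1 * (v p).2) := by
      rw [hfQ p hp, hgQ p hp]; field_simp
    rw [this]
    exact div_pos (hdet p hp) (mul_pos a b)
  set M := max Mf Mg with hM
  have hfM' : ∀ p, |f p| ≤ M := fun p => (hMf p).trans (le_max_left _ _)
  have hgM' : ∀ p, |g p| ≤ M := fun p => (hgM p).trans (le_max_right _ _)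
  have hM0 : 0 ≤ M := (abs_nonneg _).trans (hfM' 0)
  obtain ⟨η, hη, hηm⟩ : ∃ η : ℝ, 0 < η ∧ M * η < m := by
    refine ⟨m / (M + 1), by positivity, ?_⟩
    rw [← mul_div_assoc, div_lt_iff₀ (by positivity)]
    nlinarith
  obtain ⟨K₁, F, hFl, hFb, hFy⟩ := good_approx hu hu1 hu2 huint hη
  obtain ⟨K₂, G', hGl', hGb', hGx'⟩ := good_approx hv'c hv'1 hv'2 (swap_uniq hvint) hη
  set G : ℝ × ℝ → ℝ := fun p => G' p.swap with hG
  have hGb : ∀ p, g p < G p ∧ G p < g p + η := fun p => hGb' p.swap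
  have hGl : LipschitzWith K₂ G := by
    have hsw : LipschitzWith 1 (Prod.swap : ℝ × ℝ → ℝ × ℝ) := by
      have h := (LipschitzWith.prod_snd (α := ℝ) (β := ℝ)).prodMk
        (LipschitzWith.prod_fst (α := ℝ) (β := ℝ))
      rw [max_self] at h
      exact h
    have h2 := hGl'.comp hsw
    rw [mul_one] at h2
    exact h2
  obtain ⟨z, s, T, hT, hz0, hzT, hz⟩ := core (M := M + η) (hFl.weaken (le_max_left K₁ K₂))
    (hGl.weaken (le_max_right K₁ K₂))
    (fun p => by
      have h1 := hFb p
      have h2 := abs_le.1 (hfM' p)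
      rw [abs_le]; constructor <;> linarith)
    (fun p => by
      have h1 := hGb p
      have h2 := abs_le.1 (hgM' p)
      rw [abs_le]; constructor <;> linarith)
    (fun p hp => by
      have := (hFb p).1
      rwa [slopeQ_zero hu2 hp] at this)
    (fun p hp => by
      have := (hGb' p.swap).1
      rwa [slopeQ_zero hv'2 (by simpa using hp)] at this)
    hFy (fun x hx0 hx => hGx' x hx0 hx)
  have hmap : ∀ t ∈ Set.Icc (0:ℝ) 1, T * t ∈ Set.Icc 0 T := fun t ht =>
    ⟨mul_nonneg hT.le ht.1, by nlinarith [ht.2]⟩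
  have hder : ∀ t ∈ Set.Icc (0:ℝ) 1, HasDerivAt (fun t => z (T * t))
      (T • fieldQ F G (lamQ s (T * t)) (z (T * t))) t := by
    intro t ht
    have h1 : HasDerivAt (fun t : ℝ => T * t) T t := by
      simpa using (hasDerivAt_id t).const_mul T
    exact HasDerivAt.scomp t (hz _ (hmap t ht)).2 h1
  have hα0 : (fun t => z (T * t)) 0 = ((0:ℝ), (0:ℝ)) := by
    show z (T * 0) = (0, 0)
    rw [mul_zero, hz0]
    rfl
  refine ⟨fun t => z (T * t), fun t => T • fieldQ F G (lamQ s (T * t)) (z (T * t)),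
    fun t ht => (hz _ (hmap t ht)).1, hα0, by simp [hzT], ?_,
    fun t ht => (hder t ht).hasDerivWithinAt, ?_⟩
  · have hzc : ContinuousOn (fun t => z (T * t)) (Set.Icc 0 1) :=
      fun t ht => (hder t ht).continuousAt.continuousWithinAt
    have hl : Continuous (fun t => lamQ s (T * t)) := by unfold lamQ; fun_prop
    have hFz := hFl.continuous.comp_continuousOn hzc
    have hGz := hGl.continuous.comp_continuousOn hzc
    have hl' := hl.continuousOn (s := Set.Icc (0:ℝ) 1)
    refine ContinuousOn.const_smul (ContinuousOn.prodMk ?_ ?_) T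
    · exact (continuousOn_const.sub hl').add (hl'.mul hGz)
    · exact ((continuousOn_const.sub hl').mul hFz).add hl'
  · intro t ht
    have hpQ := (hz _ (hmap t ht)).1
    show ∃ a b : ℝ, 0 < a ∧ 0 < b ∧ T • fieldQ F G (lamQ s (T * t)) (z (T * t)) =
      a • u (z (T * t)) + b • v (z (T * t))
    generalize z (T * t) = p at hpQ
    obtain ⟨hl0, hl1⟩ := lamQ_mem s (T * t)
    generalize lamQ s (T * t) = l at hl0 hl1
    have hD := hm0.trans_le (hm p hpQ)
    have hmp := hm p hpQ
    have hfp := hfQ p hpQ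
    have hgp := hgQ p hpQ
    have a1 := hu1 p hpQ
    have b2 := hv2 p hpQ
    have hF1 : 0 < F p - f p := sub_pos.2 (hFb p).1
    have hF2 : F p - f p < η := by linarith [(hFb p).2]
    have hG1 : 0 < G p - g p := sub_pos.2 (hGb p).1
    have hG2 : G p - g p < η := by linarith [(hGb p).2]
    have k1 : 0 < 1 - g p * F p := by
      have h1 := (abs_le.1 (hgM' p)).2
      have : g p * (F p - f p) ≤ M * η := by
        calc g p * (F p - f p) ≤ M * (F p - f p) := by gcongr
          _ ≤ M * η := by gcongr
      nlinarith
    have k2 : 0 < 1 - f p * G p := by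
      have h1 := (abs_le.1 (hfM' p)).2
      have : f p * (G p - g p) ≤ M * η := by
        calc f p * (G p - g p) ≤ M * (G p - g p) := by gcongr
          _ ≤ M * η := by gcongr
      nlinarith
    have conv : ∀ x y : ℝ, 0 < x → 0 < y → 0 < (1 - l) * x + l * y := by
      intro x y hx hy
      rcases hl0.eq_or_lt with h | h
      · rw [← h]; simpa using hx
      · have := mul_pos h hy
        have := mul_nonneg (sub_nonneg.2 hl1) hx.le
        linarith
    have hA := conv _ _ k1 hG1
    have hB := conv _ _ hF1 k2
    refine ⟨T * (((1 - l) * (1 - g p * F p) + l * (G p - g p)) / (1 - f p * g p)) / (u p).1,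
      T * (((1 - l) * (F p - f p) + l * (1 - f p * G p)) / (1 - f p * g p)) / (v p).2,
      by positivity, by positivity, ?_⟩
    have eu : (u p).2 = f p * (u p).1 := by rw [hfp]; field_simp
    have ev : (v p).1 = g p * (v p).2 := by rw [hgp]; field_simp
    ext
    · simp only [fieldQ, Prod.smul_fst, Prod.fst_add, smul_eq_mul, ev]
      generalize f p = fp at *
      generalize g p = gp at *
      obtain ⟨D, hDd⟩ : ∃ D, D = 1 - fp * gp := ⟨_, rfl⟩
      rw [← hDd]
      have hDne : D ≠ 0 := by
        rw [hDd]
        exact hD.ne'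
      have hn1 := a1.ne'
      have hn2 := b2.ne'
      field_simp
      rw [hDd]
      ring
    · simp only [fieldQ, Prod.smul_snd, Prod.snd_add, smul_eq_mul, eu]
      generalize f p = fp at *
      generalize g p = gp at *
      obtain ⟨D, hDd⟩ : ∃ D, D = 1 - fp * gp := ⟨_, rfl⟩
      rw [← hDd]
      have hDne : D ≠ 0 := by
        rw [hDd]
        exact hD.ne'
      have hn1 := a1.ne'
      have hn2 := b2.ne'
      field_simp
      rw [hDd]
      ring
end

section
/- Fix A > 0 and an A-adapted bump function ρ. Then ρ(A) > 0, and for every continuous function k : ℝ → ℝ satisfying k(y) > k(x) + 1 whenever y > x + A, the convolution ρ⋆k is differentiable on ℝ and (ρ⋆k)'(t) ≥ ρ(A) for every t ∈ ℝ. In particular the derivative of ρ⋆k is bounded below by a positive constant depending only on ρ. -/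
open MeasureTheory

/-- An `A`-adapted bump function: a `C^∞` function `ρ : ℝ → ℝ` with `ρ ≥ 0`,
`∫ ρ = 1`, support contained in `[-A-1, A+1]`, even, constant on `[-A, A]`, and
nondecreasing on `[-A-1, -A]`. -/
def IsAdaptedBump (A : ℝ) (ρ : ℝ → ℝ) : Prop :=
  ContDiff ℝ (⊤ : ℕ∞) ρ ∧ (∀ x, 0 ≤ ρ x) ∧ (∫ x, ρ x) = 1 ∧
    (∀ x : ℝ, x ∉ Set.Icc (-(A + 1)) (A + 1) → ρ x = 0) ∧
    (∀ x, ρ (-x) = ρ x) ∧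
    (∀ x ∈ Set.Icc (-A) A, ρ x = ρ 0) ∧
    MonotoneOn ρ (Set.Icc (-(A + 1)) (-A))

/-- The convolution `(ρ⋆k)(t) = ∫ k(y) ρ(t - y) dy`. -/
noncomputable def bumpConv (ρ k : ℝ → ℝ) (t : ℝ) : ℝ := ∫ y, k y * ρ (t - y)

/-- `k : ℝ → ℝ` is `(K, δ)`-coarse Lipschitz: `|k x - k y| ≤ K|x - y| + δ` for all
`x, y`. -/
def CoarseLipschitz (K δ : ℝ) (k : ℝ → ℝ) : Prop :=
  ∀ x y : ℝ, |k x - k y| ≤ K * |x - y| + δ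

/-- Fix `A > 0` and an `A`-adapted bump function `ρ`.  Then
`ρ(A) > 0`, and for every continuous `k : ℝ → ℝ` with `k(y) > k(x) + 1` whenever
`y > x + A`, the convolution `ρ⋆k` is differentiable with `(ρ⋆k)'(t) ≥ ρ(A)` for
every `t`. -/
theorem bumpConv_deriv_ge
    (A : ℝ) (hA : 0 < A) (ρ : ℝ → ℝ) (hρ : IsAdaptedBump A ρ) :
    0 < ρ A ∧
      ∀ k : ℝ → ℝ, Continuous k → (∀ x y : ℝ, x + A < y → k x + 1 < k y) →
        Differentiable ℝ (bumpConv ρ k) ∧ ∀ t : ℝ, ρ A ≤ deriv (bumpConv ρ k) t := by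
  obtain ⟨hs, hnn, hone, hsupp, heven, hconst, hmono⟩ := hρ
  have hA0 : ρ A = ρ 0 := hconst A ⟨by linarith, le_refl _⟩
  have hM : MonotoneOn ρ (Set.Iic 0) := by
    intro x hx y hy hxy
    simp only [Set.mem_Iic] at hx hy
    by_cases h1 : x < -(A + 1)
    · rw [hsupp x (fun h => by linarith [h.1])]; exact hnn y
    push Not at h1
    by_cases h2 : x ≤ -A
    · by_cases h3 : y ≤ -A
      · exact hmono ⟨h1, h2⟩ ⟨by linarith, h3⟩ hxy
      · rw [hconst y ⟨by linarith, by linarith⟩,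
          ← hconst (-A) ⟨by linarith, by linarith⟩]
        exact hmono ⟨h1, h2⟩ ⟨by linarith, by linarith⟩ h2
    · rw [hconst y ⟨by linarith, by linarith⟩, hconst x ⟨by linarith, by linarith⟩]
  have hpos : 0 < ρ A := by
    rw [hA0]
    by_contra h
    have hle : ∀ x, x ≤ 0 → ρ x ≤ 0 := fun x hx =>
      (hM hx (Set.mem_Iic.2 le_rfl) hx).trans (not_lt.1 h)
    have hz : ∀ x, ρ x = 0 := fun x => by
      refine le_antisymm ?_ (hnn x)
      rcases le_total x 0 with hx | hx
      · exact hle x hx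
      · rw [← heven]; exact hle _ (by linarith)
    simp [hz] at hone
  refine ⟨hpos, fun k hk hkA => ?_⟩
  have hc : HasCompactSupport ρ := HasCompactSupport.intro isCompact_Icc hsupp
  have hs1 : ContDiff ℝ 1 ρ := hs.of_le (by exact_mod_cast le_top)
  have hdiff : Differentiable ℝ ρ := hs1.differentiable (by norm_num)
  have hdc : Continuous (deriv ρ) := hs1.continuous_deriv (by norm_num)
  have hD : ∀ t, HasDerivAt (bumpConv ρ k) (∫ y, k y * deriv ρ (t - y)) t := fun t =>
    hc.hasDerivAt_convolution_right (ContinuousLinearMap.mul ℝ ℝ) (μ := volume)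
      hk.locallyIntegrable hs1 t
  refine ⟨fun t => (hD t).differentiableAt, fun t => ?_⟩
  rw [(hD t).deriv]
  have hodd : ∀ u, deriv ρ (-u) = - deriv ρ u := fun u => by
    have h := deriv_comp_neg ρ u
    simp only [heven] at h
    linarith
  have e1 : ∫ y, k y * deriv ρ (t - y) = ∫ u, k (t - u) * deriv ρ u := by
    rw [← integral_sub_left_eq_self (fun u => k (t - u) * deriv ρ u) volume t]
    simp
  have hI1 : Integrable (fun u => k (t - u) * deriv ρ u) :=
    (by fun_prop : Continuous _).integrable_of_hasCompactSupport hc.deriv.mul_left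
  have hI2 : Integrable (fun u => k (t + u) * deriv ρ u) :=
    (by fun_prop : Continuous _).integrable_of_hasCompactSupport hc.deriv.mul_left
  have hI3 : Integrable (deriv ρ) := hdc.integrable_of_hasCompactSupport hc.deriv
  have e2 : ∫ u in Set.Ioi 0, k (t - u) * deriv ρ u
      = - ∫ u in Set.Iic 0, k (t + u) * deriv ρ u := by
    have h := integral_comp_neg_Iic (0 : ℝ) (fun u => k (t - u) * deriv ρ u)
    rw [neg_zero] at h
    rw [← h, ← integral_neg]
    simp [hodd]
  rw [e1, ← intervalIntegral.integral_Iic_add_Ioi (b := 0) hI1.integrableOn hI1.integrableOn, e2,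
    ← sub_eq_add_neg, ← integral_sub hI1.integrableOn hI2.integrableOn, hA0,
    ← hc.integral_Iic_deriv_eq hs1 0]
  refine setIntegral_mono_on hI3.integrableOn (hI1.sub hI2).integrableOn measurableSet_Iic ?_
  intro u hu
  simp only [Set.mem_Iic] at hu
  by_cases h : -A < u
  · have : deriv ρ u = 0 := by
      have : ρ =ᶠ[nhds u] fun _ => ρ 0 := by
        filter_upwards [Ioo_mem_nhds h (by linarith : u < A)] with x hx
        exact hconst x ⟨hx.1.le, hx.2.le⟩
      rw [this.deriv_eq]; simp
    simp [this]
  · have h0 : 0 ≤ deriv ρ u := by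
      have := hM.derivWithin_nonneg (x := u)
      rwa [derivWithin_of_mem_nhds (Iic_mem_nhds (by linarith))] at this
    have := hkA (t + u) (t - u) (by linarith)
    nlinarith
end

section
/- Fix A > 0, an A-adapted bump function ρ, and constants K, δ ≥ 0. For every continuous (K,δ)-coarse Lipschitz function k : ℝ → ℝ, the convolution ρ⋆k is differentiable on ℝ and |(ρ⋆k)'(t)| ≤ ρ(A)·(2(A+1)K + δ) for every t ∈ ℝ; in particular the derivative of ρ⋆k is bounded by a constant depending only on ρ, K, and δ. -/
open MeasureTheory

/-- Fix `A > 0`, an `A`-adapted bump function `ρ`, and `K, δ ≥ 0`.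
For every continuous `(K, δ)`-coarse Lipschitz `k : ℝ → ℝ`, the convolution `ρ⋆k` is
differentiable with `|(ρ⋆k)'(t)| ≤ ρ(A)·(2(A+1)K + δ)` for every `t`. -/
theorem bumpConv_deriv_le
    (A K δ : ℝ) (hA : 0 < A) (hK : 0 ≤ K) (hδ : 0 ≤ δ)
    (ρ : ℝ → ℝ) (hρ : IsAdaptedBump A ρ)
    (k : ℝ → ℝ) (hk : Continuous k) (hkl : CoarseLipschitz K δ k) :
    Differentiable ℝ (bumpConv ρ k) ∧
      ∀ t : ℝ, |deriv (bumpConv ρ k) t| ≤ ρ A * (2 * (A + 1) * K + δ) := by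
  obtain ⟨hsm, hpos, -, hsupp, heven, hconst, hmono⟩ := hρ
  have hcs : HasCompactSupport ρ := HasCompactSupport.intro isCompact_Icc hsupp
  have hsm1 : ContDiff ℝ 1 ρ := hsm.of_le (by exact_mod_cast le_top)
  have hdc : Continuous (deriv ρ) := hsm1.continuous_deriv le_rfl
  have hder : ∀ t, HasDerivAt (bumpConv ρ k) (∫ y, k y * deriv ρ (t - y)) t := fun t =>
    HasCompactSupport.hasDerivAt_convolution_right (ContinuousLinearMap.mul ℝ ℝ) (μ := volume)
      hk.locallyIntegrable hcs hsm1 t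
  have hodd : ∀ s, deriv ρ (-s) = - deriv ρ s := by
    intro s
    have h1 := deriv_comp_neg ρ s
    have h2 : (fun x => ρ (-x)) = ρ := funext heven
    rw [h2] at h1
    linarith
  have hdcs : HasCompactSupport (deriv ρ) := hcs.deriv
  have hdz : ∀ s, s ∉ Set.Icc (-(A + 1)) (A + 1) → deriv ρ s = 0 := by
    intro s hs
    by_contra hne
    apply hs
    have h1 : s ∈ tsupport ρ := support_deriv_subset hne
    have h2 : tsupport ρ ⊆ Set.Icc (-(A + 1)) (A + 1) := by
      apply closure_minimal _ isClosed_Icc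
      intro x hx
      by_contra hx'
      exact hx (hsupp x hx')
    exact h2 h1
  have hρA : ρ A = ρ 0 := hconst A ⟨by linarith, le_rfl⟩
  have hanti : AntitoneOn ρ (Set.Ici 0) := by
    have key : ∀ x y, A ≤ x → x ≤ y → y ≤ A + 1 → ρ y ≤ ρ x := by
      intro x y h1 h2 h3
      rw [← heven x, ← heven y]
      exact hmono ⟨by linarith, by linarith⟩ ⟨by linarith, by linarith⟩ (by linarith)
    intro x hx y hy hxy
    have hx0 : (0:ℝ) ≤ x := hx
    by_cases h1 : A + 1 < y
    · rw [hsupp y (fun h => absurd h.2 (not_le.mpr h1))]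
      exact hpos x
    push Not at h1
    by_cases h2 : A ≤ x
    · exact key x y h2 hxy h1
    push Not at h2
    have hxe : ρ x = ρ 0 := hconst x ⟨by linarith, h2.le⟩
    by_cases h3 : y ≤ A
    · rw [hxe, hconst y ⟨by linarith, h3⟩]
    · push Not at h3
      rw [hxe, ← hρA]
      exact key A y le_rfl h3.le h1
  have hneg : ∀ s ∈ Set.Ioi (0:ℝ), deriv ρ s ≤ 0 := by
    intro s hs
    have h1 := hanti.derivWithin_nonpos (x := s)
    rwa [derivWithin_of_mem_nhds (Ici_mem_nhds hs)] at h1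
  have htot : ∫ s, |deriv ρ s| = 2 * ρ A := by
    have h1 : ∀ s, |deriv ρ s| = (fun x => |deriv ρ x|) |s| := by
      intro s
      rcases abs_choice s with h | h <;> simp only [h, hodd, abs_neg]
    calc ∫ s, |deriv ρ s| = ∫ s, (fun x => |deriv ρ x|) |s| := integral_congr_ae (.of_forall h1)
      _ = 2 * ∫ s in Set.Ioi (0:ℝ), |deriv ρ s| := integral_comp_abs (f := fun x => |deriv ρ x|)
      _ = 2 * ∫ s in Set.Ioi (0:ℝ), - deriv ρ s := by
        congr 1
        exact setIntegral_congr_fun measurableSet_Ioi (fun s hs => abs_of_nonpos (hneg s hs))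
      _ = 2 * ρ A := by
        rw [integral_neg, hcs.integral_Ioi_deriv_eq hsm1, hρA, neg_neg]
  refine ⟨fun t => (hder t).differentiableAt, fun t => ?_⟩
  rw [(hder t).deriv]
  have e1 : ∫ y, k y * deriv ρ (t - y) = ∫ s, k (t - s) * deriv ρ s := by
    rw [← integral_sub_left_eq_self (fun y => k y * deriv ρ (t - y)) volume t]
    simp
  have e2 : ∫ s, k (t - s) * deriv ρ s = - ∫ s, k (t + s) * deriv ρ s := by
    rw [← integral_neg_eq_self (fun s => k (t - s) * deriv ρ s), ← integral_neg]
    simp [hodd]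
  have i1 : Integrable (fun s => k (t - s) * deriv ρ s) :=
    Continuous.integrable_of_hasCompactSupport (by fun_prop) hdcs.mul_left
  have i2 : Integrable (fun s => k (t + s) * deriv ρ s) :=
    Continuous.integrable_of_hasCompactSupport (by fun_prop) hdcs.mul_left
  have i3 : Integrable (fun s => |deriv ρ s|) :=
    (hdc.integrable_of_hasCompactSupport hdcs).abs
  have e3 : 2 * ∫ s, k (t - s) * deriv ρ s = ∫ s, (k (t - s) - k (t + s)) * deriv ρ s := by
    simp only [sub_mul]
    rw [integral_sub i1 i2]
    linarith
  have b : |∫ s, (k (t - s) - k (t + s)) * deriv ρ s|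
      ≤ ∫ s, (2 * (A + 1) * K + δ) * |deriv ρ s| := by
    rw [← Real.norm_eq_abs]
    apply norm_integral_le_of_norm_le (i3.const_mul _)
    refine .of_forall fun s => ?_
    rw [Real.norm_eq_abs, abs_mul]
    by_cases hs : s ∈ Set.Icc (-(A + 1)) (A + 1)
    · apply mul_le_mul_of_nonneg_right _ (abs_nonneg _)
      refine (hkl _ _).trans ?_
      have h1 : |t - s - (t + s)| ≤ 2 * (A + 1) := by
        rw [abs_le]
        constructor <;> linarith [hs.1, hs.2]
      nlinarith [mul_le_mul_of_nonneg_left h1 hK]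
    · simp [hdz s hs]
  rw [integral_const_mul, htot, ← e3, abs_mul, abs_two] at b
  rw [e1]
  linarith
end

section
/- Fix A > 0, an A-adapted bump function ρ, and constants K, δ ≥ 0. Let k : ℝ → ℝ be continuous, (K,δ)-coarse Lipschitz, and satisfy k(y) > k(x) + 1 whenever y > x + A. Then f = ρ⋆k is an infinitely differentiable function with ρ(A) ≤ f'(t) ≤ ρ(A)·(2(A+1)K + δ) for all t ∈ ℝ; consequently f is a strictly increasing homeomorphism of ℝ onto ℝ, and sup_{t∈ℝ} |f(t) − k(t)| ≤ K(A+1) + δ. -/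
open MeasureTheory

theorem aux_antitone {A : ℝ} {ρ : ℝ → ℝ} (hA : 0 < A) (hρ : IsAdaptedBump A ρ) :
    AntitoneOn ρ (Set.Ici 0) := by
  obtain ⟨hs, hnn, hint, hsupp, heven, hconst, hmono⟩ := hρ
  intro x hx y hy hxy
  simp only [Set.mem_Ici] at hx hy
  by_cases hy1 : A + 1 < y
  · rw [hsupp y (fun h => absurd h.2 (not_le.mpr hy1))]
    exact hnn x
  push Not at hy1
  by_cases hxA : x ≤ A
  · rw [hconst x ⟨by linarith, hxA⟩]
    by_cases hyA : y ≤ A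
    · rw [hconst y ⟨by linarith, hyA⟩]
    · push Not at hyA
      rw [← hconst (-A) ⟨le_refl _, by linarith⟩, ← heven y]
      exact hmono ⟨by linarith, by linarith⟩ ⟨by linarith, by linarith⟩ (by linarith)
  · push Not at hxA
    rw [← heven y, ← heven x]
    exact hmono ⟨by linarith, by linarith⟩ ⟨by linarith, by linarith⟩ (by linarith)

theorem aux_pos {A : ℝ} {ρ : ℝ → ℝ} (hA : 0 < A) (hρ : IsAdaptedBump A ρ) :
    0 < ρ A := by
  have hanti := aux_antitone hA hρ
  obtain ⟨hs, hnn, hint, hsupp, heven, hconst, hmono⟩ := hρ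
  by_contra hcon
  have h0 : ρ 0 = 0 := by
    rw [← hconst A ⟨by linarith, le_refl _⟩]
    exact le_antisymm (not_lt.mp hcon) (hnn A)
  have hz : ∀ x, ρ x = 0 := by
    intro x
    have h1 : ρ |x| = ρ x := by
      rcases abs_choice x with h | h <;> rw [h]
      exact heven x
    have := hanti (Set.mem_Ici.mpr le_rfl) (Set.mem_Ici.mpr (abs_nonneg x)) (abs_nonneg x)
    rw [← h1]
    exact le_antisymm (this.trans_eq h0) (hnn _)
  simp [hz] at hint

theorem aux_deriv_zero {A : ℝ} {ρ : ℝ → ℝ} (hρ : IsAdaptedBump A ρ)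
    {s : ℝ} (h1 : -A < s) (h2 : s < A) : deriv ρ s = 0 := by
  obtain ⟨hs, hnn, hint, hsupp, heven, hconst, hmono⟩ := hρ
  have : ρ =ᶠ[nhds s] fun _ => ρ 0 := by
    filter_upwards [Ioo_mem_nhds h1 h2] with x hx
    exact hconst x ⟨hx.1.le, hx.2.le⟩
  rw [this.deriv_eq]
  simp

theorem aux_deriv_out {A : ℝ} {ρ : ℝ → ℝ} (hρ : IsAdaptedBump A ρ)
    {s : ℝ} (h : s ∉ Set.Icc (-(A + 1)) (A + 1)) : deriv ρ s = 0 := by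
  obtain ⟨hs, hnn, hint, hsupp, heven, hconst, hmono⟩ := hρ
  have : ρ =ᶠ[nhds s] fun _ => 0 := by
    filter_upwards [isClosed_Icc.isOpen_compl.mem_nhds h] with x hx
    exact hsupp x hx
  rw [this.deriv_eq]
  simp

theorem aux_deriv_nonpos {A : ℝ} {ρ : ℝ → ℝ} (hA : 0 < A) (hρ : IsAdaptedBump A ρ)
    {s : ℝ} (h : 0 < s) : deriv ρ s ≤ 0 := by
  have hanti := aux_antitone hA hρ
  rw [← derivWithin_of_mem_nhds (Ici_mem_nhds h)]
  exact hanti.derivWithin_nonpos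

theorem aux_cs {A : ℝ} {ρ : ℝ → ℝ} (hρ : IsAdaptedBump A ρ) : HasCompactSupport ρ :=
  HasCompactSupport.intro isCompact_Icc hρ.2.2.2.1

theorem aux_conv (ρ k : ℝ → ℝ) :
    bumpConv ρ k = convolution k ρ (ContinuousLinearMap.mul ℝ ℝ) volume := by
  ext t
  simp [bumpConv, convolution]

theorem aux_deriv_formula {A : ℝ} {ρ k : ℝ → ℝ} (hA : 0 < A) (hρ : IsAdaptedBump A ρ)
    (hk : Continuous k) (t : ℝ) :
    deriv (bumpConv ρ k) t =
      ∫ s in (0 : ℝ)..(A + 2), (k (t + s) - k (t - s)) * (-deriv ρ s) := by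
  have hcd : Continuous (deriv ρ) := hρ.1.continuous_deriv (by simp)
  have h1 : ContDiff ℝ 1 ρ := hρ.1.of_le (by simp)
  have hd := ((aux_cs hρ).hasDerivAt_convolution_right (ContinuousLinearMap.mul ℝ ℝ)
    (hk.locallyIntegrable (μ := volume)) h1 t).deriv
  rw [aux_conv, hd]
  have e1 : convolution k (deriv ρ) (ContinuousLinearMap.mul ℝ ℝ) volume t
      = ∫ s, k (t - s) * deriv ρ s := by
    rw [← integral_sub_left_eq_self _ volume t]
    simp [convolution]
  rw [e1]
  have hc1 : Continuous fun s => k (t - s) * deriv ρ s := by fun_prop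
  have hc2 : Continuous fun s => k (t + s) * deriv ρ s := by fun_prop
  rw [← intervalIntegral.integral_eq_integral_of_support_subset (a := -(A + 2)) (b := A + 2)]
  · rw [← intervalIntegral.integral_add_adjacent_intervals (b := 0)
      (hc1.intervalIntegrable _ _) (hc1.intervalIntegrable _ _)]
    have e2 : ∫ s in (-(A + 2))..0, k (t - s) * deriv ρ s
        = ∫ s in (0 : ℝ)..(A + 2), -(k (t + s) * deriv ρ s) := by
      have hev : (fun x => ρ (-x)) = ρ := funext hρ.2.2.2.2.1
      have hodd : ∀ s, deriv ρ (-s) = - deriv ρ s := by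
        intro s
        have := deriv_comp_neg ρ s
        rw [hev] at this
        linarith
      have := intervalIntegral.integral_comp_neg (a := 0) (b := A + 2)
        (fun s => k (t - s) * deriv ρ s)
      rw [neg_zero] at this
      rw [← this]
      congr 1
      ext s
      rw [hodd, sub_neg_eq_add]
      ring
    have hc3 : Continuous fun s => -(k (t + s) * deriv ρ s) := by fun_prop
    rw [e2, ← intervalIntegral.integral_add (hc3.intervalIntegrable _ _)
      (hc1.intervalIntegrable _ _)]
    congr 1
    ext s
    ring
  · intro s hs
    by_contra hcon
    apply hs
    have : deriv ρ s = 0 := by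
      apply aux_deriv_out hρ
      intro h
      exact hcon ⟨by linarith [h.1], by linarith [h.2]⟩
    simp [this]

theorem aux_ftc {A : ℝ} {ρ : ℝ → ℝ} (hA : 0 < A) (hρ : IsAdaptedBump A ρ) :
    ∫ s in (0 : ℝ)..(A + 2), (-deriv ρ s) = ρ A := by
  have hcd : Continuous (deriv ρ) := hρ.1.continuous_deriv (by simp)
  rw [intervalIntegral.integral_neg, intervalIntegral.integral_deriv_eq_sub
    (fun x _ => (hρ.1.differentiable (by simp)).differentiableAt)
    (hcd.intervalIntegrable _ _), hρ.2.2.2.1 (A + 2) (fun h => by linarith [h.2]),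
    hρ.2.2.2.2.2.1 A ⟨by linarith, le_refl _⟩]
  ring

theorem aux_bound {A K δ : ℝ} (hA : 0 < A) (hK : 0 ≤ K)
    {ρ : ℝ → ℝ} (hρ : IsAdaptedBump A ρ)
    {k : ℝ → ℝ} (hk : Continuous k) (hkl : CoarseLipschitz K δ k)
    (hprog : ∀ x y : ℝ, x + A < y → k x + 1 < k y) (t : ℝ) :
    ρ A ≤ deriv (bumpConv ρ k) t ∧
        deriv (bumpConv ρ k) t ≤ ρ A * (2 * (A + 1) * K + δ) := by
  have hcd : Continuous (deriv ρ) := hρ.1.continuous_deriv (by simp)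
  have hc : Continuous fun s => (k (t + s) - k (t - s)) * (-deriv ρ s) := by fun_prop
  have hcn : Continuous fun s => -deriv ρ s := by fun_prop
  have hcm : Continuous fun s => -deriv ρ s * (2 * (A + 1) * K + δ) := by fun_prop
  rw [aux_deriv_formula hA hρ hk]
  constructor
  · rw [← aux_ftc hA hρ]
    apply intervalIntegral.integral_mono_on (by linarith) (hcn.intervalIntegrable _ _)
      (hc.intervalIntegrable _ _)
    intro s hs
    by_cases h : s < A
    · simp [aux_deriv_zero hρ (by linarith [hs.1]) h]
    · push Not at h
      have h1 := aux_deriv_nonpos hA hρ (s := s) (by linarith)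
      have h2 := hprog (t - s) (t + s) (by linarith)
      nlinarith
  · rw [← aux_ftc hA hρ, ← intervalIntegral.integral_mul_const]
    apply intervalIntegral.integral_mono_on (by linarith) (hc.intervalIntegrable _ _)
      (hcm.intervalIntegrable _ _)
    intro s hs
    by_cases h : s < A
    · simp [aux_deriv_zero hρ (by linarith [hs.1]) h]
    · push Not at h
      by_cases h' : s ≤ A + 1
      · have h1 := aux_deriv_nonpos hA hρ (s := s) (by linarith)
        have h2 := (le_abs_self _).trans (hkl (t + s) (t - s))
        have e : |t + s - (t - s)| = 2 * s := by
          rw [abs_of_nonneg (by linarith)]; ring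
        rw [e] at h2
        have h3 : K * (2 * s) ≤ 2 * (A + 1) * K := by nlinarith
        rw [mul_comm]
        exact mul_le_mul_of_nonneg_left (by linarith) (by linarith)
      · rw [aux_deriv_out hρ (fun hh => h' hh.2)]
        simp

theorem aux_dist {A K δ : ℝ} (hK : 0 ≤ K)
    {ρ : ℝ → ℝ} (hρ : IsAdaptedBump A ρ)
    {k : ℝ → ℝ} (hk : Continuous k) (hkl : CoarseLipschitz K δ k) (t : ℝ) :
    |bumpConv ρ k t - k t| ≤ K * (A + 1) + δ := by
  have hcs := aux_cs hρ
  have hcr : Continuous ρ := hρ.1.continuous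
  have e1 : bumpConv ρ k t = ∫ s, k (t - s) * ρ s := by
    rw [← integral_sub_left_eq_self _ volume t]
    simp [bumpConv]
  have i1 : Integrable (fun s => k (t - s) * ρ s) :=
    Continuous.integrable_of_hasCompactSupport (by fun_prop) (hcs.mul_left)
  have i0 : Integrable ρ := hcr.integrable_of_hasCompactSupport hcs
  have e2 : bumpConv ρ k t - k t = ∫ s, (k (t - s) - k t) * ρ s := by
    have : k t = ∫ s, k t * ρ s := by rw [integral_const_mul, hρ.2.2.1, mul_one]
    have e3 : ∫ s, (k (t - s) - k t) * ρ s = (∫ s, k (t - s) * ρ s) - ∫ s, k t * ρ s := by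
      rw [← integral_sub i1 (i0.const_mul _)]
      congr 1
      ext s
      ring
    rw [e3, e1, ← this]
  rw [e2, ← Real.norm_eq_abs]
  have : K * (A + 1) + δ = ∫ s, (K * (A + 1) + δ) * ρ s := by
    rw [integral_const_mul, hρ.2.2.1, mul_one]
  rw [this]
  apply norm_integral_le_of_norm_le (i0.const_mul _)
  refine Filter.Eventually.of_forall fun s => ?_
  rw [norm_mul, Real.norm_eq_abs, Real.norm_eq_abs, abs_of_nonneg (hρ.2.1 s)]
  by_cases h : s ∈ Set.Icc (-(A + 1)) (A + 1)
  · apply mul_le_mul_of_nonneg_right _ (hρ.2.1 s)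
    have h2 := hkl (t - s) t
    have h3 : |t - s - t| ≤ A + 1 := by
      rw [abs_le]; constructor <;> linarith [h.1, h.2]
    have := mul_le_mul_of_nonneg_left h3 hK
    linarith
  · rw [hρ.2.2.2.1 s h]; simp

theorem bumpConv_straightening
    (A K δ : ℝ) (hA : 0 < A) (hK : 0 ≤ K) (hδ : 0 ≤ δ)
    (ρ : ℝ → ℝ) (hρ : IsAdaptedBump A ρ)
    (k : ℝ → ℝ) (hk : Continuous k) (hkl : CoarseLipschitz K δ k)
    (hprog : ∀ x y : ℝ, x + A < y → k x + 1 < k y) :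
    ContDiff ℝ (⊤ : ℕ∞) (bumpConv ρ k) ∧
      (∀ t : ℝ, ρ A ≤ deriv (bumpConv ρ k) t ∧
        deriv (bumpConv ρ k) t ≤ ρ A * (2 * (A + 1) * K + δ)) ∧
      StrictMono (bumpConv ρ k) ∧
      Continuous (bumpConv ρ k) ∧
      Function.Bijective (bumpConv ρ k) ∧
      ∀ t : ℝ, |bumpConv ρ k t - k t| ≤ K * (A + 1) + δ := by
  have hsm : ContDiff ℝ (⊤ : ℕ∞) (bumpConv ρ k) := by
    rw [aux_conv]
    exact (aux_cs hρ).contDiff_convolution_right _ hk.locallyIntegrable hρ.1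
  have hb := fun t => aux_bound hA hK hρ hk hkl hprog t
  have hpos := aux_pos hA hρ
  have hstrict : StrictMono (bumpConv ρ k) :=
    strictMono_of_deriv_pos fun t => hpos.trans_le (hb t).1
  have hdiff : Differentiable ℝ (bumpConv ρ k) := hsm.differentiable (by simp)
  have hm : Monotone fun t => bumpConv ρ k t - ρ A * t := by
    apply monotone_of_deriv_nonneg (by fun_prop)
    intro t
    have : HasDerivAt (fun t => bumpConv ρ k t - ρ A * t)
        (deriv (bumpConv ρ k) t - ρ A * 1) t :=
      (hdiff t).hasDerivAt.sub ((hasDerivAt_id t).const_mul (ρ A))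
    rw [this.deriv]
    linarith [(hb t).1]
  refine ⟨hsm, hb, hstrict, hsm.continuous, ⟨hstrict.injective, ?_⟩,
    aux_dist hK hρ hk hkl⟩
  apply hsm.continuous.surjective
  · have h1 : Filter.Tendsto (fun t => bumpConv ρ k 0 + ρ A * t) Filter.atTop Filter.atTop :=
      Filter.tendsto_atTop_add_const_left _ _ (Filter.tendsto_id.const_mul_atTop hpos)
    refine Filter.tendsto_atTop_mono' _ ?_ h1
    filter_upwards [Filter.eventually_ge_atTop 0] with t ht
    have := hm ht
    simp only at this
    linarith
  · have h1 : Filter.Tendsto (fun t => bumpConv ρ k 0 + ρ A * t) Filter.atBot Filter.atBot :=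
      Filter.tendsto_atBot_add_const_left _ _ (Filter.tendsto_id.const_mul_atBot hpos)
    refine Filter.tendsto_atBot_mono' _ ?_ h1
    filter_upwards [Filter.eventually_le_atBot 0] with t ht
    have := hm ht
    simp only at this
    linarith
end

section
/- Let D be a finite directed multigraph and let α be an edge weighting of D that is positive on every directed cycle. Then gr_D(α) > 1 if and only if D has infinitely many primitive directed cycles. -/
/-- A directed cycle is primitive if its cyclic edge sequence is not obtained by
traversing a shorter directed cycle `k ≥ 2` times. -/
def Multidigraph.IsPrimitive {V E : Type} (D : Multidigraph V E) (c : D.Cycle) : Prop :=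
  ∀ l : { l : List E // D.IsCycleWord l }, Quotient.mk D.cycleSetoid l = c →
    ∀ (m : List E) (k : ℕ), 2 ≤ k → l.1 ≠ (List.replicate k m).flatten

namespace GrAux
open Multidigraph Filter Topology

variable {V E : Type}

/-- power of a word -/
def lpow (m : List E) (k : ℕ) : List E := (List.replicate k m).flatten

theorem lpow_zero (m : List E) : lpow m 0 = [] := by simp [lpow]

theorem lpow_succ (m : List E) (k : ℕ) : lpow m (k+1) = m ++ lpow m k := by
  simp [lpow, List.replicate_succ]

theorem lpow_one (m : List E) : lpow m 1 = m := by simp [lpow]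

theorem lpow_add (m : List E) (j k : ℕ) : lpow m (j+k) = lpow m j ++ lpow m k := by
  unfold lpow; rw [List.replicate_add, List.flatten_append]

theorem lpow_mul (m : List E) (j k : ℕ) : lpow (lpow m j) k = lpow m (k * j) := by
  induction k with
  | zero => simp [lpow_zero]
  | succ k ih => rw [lpow_succ, ih, ← lpow_add]; congr 1; ring

theorem lpow_length (m : List E) (k : ℕ) : (lpow m k).length = k * m.length := by
  simp [lpow]

theorem lpow_shift (a b : List E) (k : ℕ) : lpow (a ++ b) k ++ a = a ++ lpow (b ++ a) k := by
  induction k with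
  | zero => simp [lpow_zero]
  | succ k ih => rw [lpow_succ, List.append_assoc, ih, lpow_succ]; simp

theorem lpow_rot {m m' : List E} (h : m ~r m') (k : ℕ) : lpow m k ~r lpow m' k := by
  cases k with
  | zero => simp [lpow_zero]
  | succ k =>
    obtain ⟨n, hn, rfl⟩ := List.isRotated_iff_mod.1 h
    rw [List.rotate_eq_drop_append_take hn]
    set a := m.take n with ha
    set b := m.drop n with hb
    have hm : m = a ++ b := by simp [ha, hb]
    rw [hm]
    have h1 : lpow (a ++ b) (k+1) = a ++ (lpow (b ++ a) k ++ b) := by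
      rw [lpow_succ, List.append_assoc, ← lpow_shift b a]
    have h2 : lpow (b ++ a) (k+1) = (lpow (b ++ a) k ++ b) ++ a := by
      rw [lpow_add, lpow_one]; simp
    rw [h1, h2]
    exact List.isRotated_append

theorem comm_pow (n : ℕ) : ∀ p q : List E, p.length + q.length ≤ n → p ++ q = q ++ p →
    ∃ r a b, p = lpow r a ∧ q = lpow r b := by
  induction n with
  | zero =>
    intro p q h _
    have hp : p = [] := List.length_eq_zero_iff.1 (by omega)
    have hq : q = [] := List.length_eq_zero_iff.1 (by omega)
    exact ⟨[], 0, 0, by simp [hp, lpow], by simp [hq, lpow]⟩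
  | succ n ih =>
    intro p q h e
    by_cases hp : p = []
    · exact ⟨q, 0, 1, by simp [hp, lpow], by simp [lpow]⟩
    by_cases hq : q = []
    · exact ⟨p, 1, 0, by simp [lpow], by simp [hq, lpow]⟩
    have hp' := List.length_pos_iff.2 hp
    have hq' := List.length_pos_iff.2 hq
    rcases List.append_eq_append_iff.1 e with ⟨t, ht, _⟩ | ⟨t, ht, _⟩
    · subst ht
      simp only [List.append_assoc, List.append_cancel_left_eq] at e
      simp only [List.length_append] at h
      obtain ⟨r, a, b, h1, h2⟩ := ih p t (by omega) e
      exact ⟨r, a, a + b, h1, by rw [lpow_add, ← h1, ← h2]⟩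
    · subst ht
      simp only [List.append_assoc, List.append_cancel_left_eq] at e
      simp only [List.length_append] at h
      obtain ⟨r, a, b, h1, h2⟩ := ih t q (by omega) e
      exact ⟨r, b + a, b, by rw [lpow_add, ← h1, ← h2], h2⟩

/-- walks -/
def Wk (D : Multidigraph V E) : V → List E → V → Prop
  | u, [], v => u = v
  | u, e :: l, v => D.src e = u ∧ Wk D (D.tgt e) l v

variable {D : Multidigraph V E}

theorem wk_append {u v : V} {l l' : List E} :
    Wk D u (l ++ l') v ↔ ∃ x, Wk D u l x ∧ Wk D x l' v := by
  induction l generalizing u with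
  | nil => simp [Wk]
  | cons e l ih => simp [Wk, ih, and_assoc]

theorem wk_iff {u v : V} {l : List E} (h : l ≠ []) :
    Wk D u l v ↔ D.src (l[0]'(List.length_pos_iff.2 h)) = u ∧
      (∀ i (hi : i + 1 < l.length), D.tgt l[i] = D.src l[i+1]) ∧
      D.tgt (l[l.length - 1]'(Nat.sub_lt (List.length_pos_iff.2 h) one_pos)) = v := by
  induction l generalizing u with
  | nil => exact absurd rfl h
  | cons e l ih =>
    by_cases hl : l = []
    · subst hl; simp [Wk]
    · have hpos := List.length_pos_iff.2 hl
      rw [Wk, ih hl]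
      simp only [List.getElem_cons_zero, List.length_cons]
      have hlast : (e :: l)[l.length + 1 - 1]'(by simp) = l[l.length - 1] := by
        simp only [Nat.add_sub_cancel]
        rw [List.getElem_cons]; simp [hpos.ne']
      rw [hlast]
      constructor
      · rintro ⟨h1, h2, h3, h4⟩
        refine ⟨h1, ?_, h4⟩
        intro i hi
        cases i with
        | zero => simpa using h2.symm
        | succ i => simpa using h3 i (by omega)
      · rintro ⟨h1, h2, h4⟩
        refine ⟨h1, ?_, ?_, h4⟩
        · simpa using (h2 0 (by omega)).symm
        · intro i hi
          have := h2 (i+1) (by omega)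
          rwa [List.getElem_cons_succ, List.getElem_cons_succ] at this

theorem cw_iff {l : List E} : D.IsCycleWord l ↔ l ≠ [] ∧ ∃ u, Wk D u l u := by
  unfold IsCycleWord
  constructor
  · rintro ⟨h, H⟩
    have hpos := List.length_pos_iff.2 h
    refine ⟨h, D.src (l[0]), (wk_iff h).2 ⟨rfl, ?_, ?_⟩⟩
    · intro i hi
      exact H ⟨i, by omega⟩ ⟨i+1, hi⟩ (Nat.mod_eq_of_lt hi)
    · refine H ⟨l.length - 1, by omega⟩ ⟨0, hpos⟩ ?_
      simp only [Nat.sub_add_cancel hpos, Nat.mod_self]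
  · rintro ⟨h, u, H⟩
    have hpos := List.length_pos_iff.2 h
    obtain ⟨h1, h2, h3⟩ := (wk_iff h).1 H
    refine ⟨h, ?_⟩
    rintro ⟨i, hi⟩ ⟨j, hj⟩ hij
    simp only [List.get_eq_getElem] at *
    by_cases hc : i + 1 < l.length
    · rw [Nat.mod_eq_of_lt hc] at hij
      subst hij
      exact h2 i hc
    · have : i = l.length - 1 := by omega
      subst this
      rw [Nat.sub_add_cancel hpos, Nat.mod_self] at hij
      subst hij
      rw [h3, h1]

theorem wk_split {u v : V} {l : List E} (h : Wk D u l v) (i : ℕ) (hi : i < l.length) :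
    Wk D u (l.take i) (D.src l[i]) ∧ Wk D (D.src l[i]) (l.drop i) v := by
  rw [← List.take_append_drop i l, wk_append] at h
  obtain ⟨x, h1, h2⟩ := h
  have : D.src l[i] = x := by
    rw [List.drop_eq_getElem_cons hi] at h2
    exact h2.1
  rw [this]; exact ⟨h1, h2⟩

theorem wk_start {u v : V} {l l' : List E} {u' v' : V} (h : Wk D u l v) (hl : l ≠ [])
    (h' : Wk D u' (l ++ l') v') : u = u' := by
  cases l with
  | nil => exact absurd rfl hl
  | cons e l => exact h.1.symm.trans h'.1

theorem cw_of_lpow {m : List E} {k : ℕ} (h : D.IsCycleWord (lpow m k)) : D.IsCycleWord m := by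
  obtain ⟨hne, u, hw⟩ := cw_iff.1 h
  have hm : m ≠ [] := by
    rintro rfl
    exact hne (by simp [lpow])
  have hk : k ≠ 0 := by
    rintro rfl
    exact hne (by simp [lpow])
  obtain ⟨k, rfl⟩ := Nat.exists_eq_succ_of_ne_zero hk
  rw [Nat.succ_eq_add_one, lpow_succ] at hw
  obtain ⟨x, h1, h2⟩ := wk_append.1 hw
  refine cw_iff.2 ⟨hm, u, ?_⟩
  cases k with
  | zero =>
    rw [lpow_zero] at h2
    have : x = u := h2
    rwa [this] at h1
  | succ k =>
    rw [lpow_succ] at h2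
    have := wk_start h1 hm h2
    rwa [← this] at h1

/-- class of a word -/
def cls (D : Multidigraph V E) (l : List E) (h : D.IsCycleWord l) : D.Cycle :=
  Quotient.mk D.cycleSetoid ⟨l, h⟩

theorem cls_eq {l l' : List E} {h : D.IsCycleWord l} {h' : D.IsCycleWord l'} :
    cls D l h = cls D l' h' ↔ l ~r l' :=
  ⟨fun H => Quotient.exact H, fun H => Quotient.sound H⟩

theorem cls_surj (c : D.Cycle) : ∃ l h, c = cls D l h := by
  induction c using Quotient.inductionOn with
  | h l => exact ⟨l.1, l.2, rfl⟩

theorem weight_cls (α : E → ℝ) (l : List E) (h : D.IsCycleWord l) :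
    D.weight α (cls D l h) = (l.map α).sum := rfl

theorem not_prim {c : D.Cycle} (h : ¬ D.IsPrimitive c) :
    ∃ m k, 2 ≤ k ∧ ∃ h, c = cls D (lpow m k) h := by
  unfold Multidigraph.IsPrimitive at h
  push Not at h
  obtain ⟨⟨l, hl⟩, h1, m, k, hk, h2⟩ := h
  simp only at h2
  subst h2
  exact ⟨m, k, hk, hl, h1.symm⟩

theorem prim_word {l : List E} {h : D.IsCycleWord l} (hp : D.IsPrimitive (cls D l h))
    {m : List E} {k : ℕ} (e : l = lpow m k) : k = 1 := by
  by_contra hk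
  have h0 : k ≠ 0 := by
    rintro rfl
    exact h.1 (by rw [e, lpow_zero])
  exact hp ⟨l, h⟩ rfl m k (by omega) e

theorem exists_root (n : ℕ) : ∀ (l : List E) (_ : D.IsCycleWord l), l.length ≤ n →
    ∃ p k, ∃ hp : D.IsCycleWord p, D.IsPrimitive (cls D p hp) ∧ k ≤ l.length ∧ l ~r lpow p k := by
  induction n with
  | zero =>
    intro l h hl
    exact absurd (List.length_eq_zero_iff.1 (by omega)) h.1
  | succ n ih =>
    intro l h hl
    by_cases hp : D.IsPrimitive (cls D l h)
    · exact ⟨l, 1, h, hp, List.length_pos_iff.2 h.1, by rw [lpow_one]⟩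
    · obtain ⟨m, k, hk, hw, e⟩ := not_prim hp
      have e' := cls_eq.1 e
      have hm := cw_of_lpow hw
      have hlen : l.length = k * m.length := by rw [e'.perm.length_eq, lpow_length]
      have hpos := List.length_pos_iff.2 hm.1
      obtain ⟨p, j, hp, hpp, hj, hr⟩ := ih m hm (by nlinarith)
      refine ⟨p, k * j, hp, hpp, ?_, ?_⟩
      · rw [hlen]; exact Nat.mul_le_mul_left k hj
      · rw [← lpow_mul]
        exact e'.trans (lpow_rot hr k)

theorem exists_delta [Fintype V] [Fintype E] (α : E → ℝ) (hα : ∀ c : D.Cycle, 0 < D.weight α c) :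
    ∃ δ > 0, ∀ l, D.IsCycleWord l → δ * l.length ≤ (l.map α).sum := by
  classical
  let S : Set (List E) := {l | D.IsCycleWord l ∧ l.length ≤ Fintype.card V}
  have hS : S.Finite := (List.finite_length_le E (Fintype.card V)).subset (fun l h => h.2)
  have h1 : ∃ ε > 0, ∀ l ∈ S, ε ≤ (l.map α).sum := by
    by_cases hne : S.Nonempty
    · obtain ⟨a, ha, hmin⟩ := Set.exists_min_image S (fun l => (l.map α).sum) hS hne
      exact ⟨_, hα (cls D a ha.1), hmin⟩
    · exact ⟨1, one_pos, fun l hl => absurd ⟨l, hl⟩ hne⟩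
  obtain ⟨ε, hε, hmin⟩ := h1
  have hN : (0:ℝ) < Fintype.card V + 1 := by positivity
  refine ⟨ε / (Fintype.card V + 1), by positivity, ?_⟩
  have key : ∀ n : ℕ, ∀ l : List E, l.length ≤ n → D.IsCycleWord l →
      ε / (Fintype.card V + 1) * l.length ≤ (l.map α).sum := by
    intro n
    induction n with
    | zero =>
      intro l hl h
      exact absurd (List.length_eq_zero_iff.1 (by omega)) h.1
    | succ n ih =>
      intro l hl h
      by_cases hc : l.length ≤ Fintype.card V
      · refine le_trans ?_ (hmin l ⟨h, hc⟩)
        rw [div_mul_eq_mul_div, div_le_iff₀ hN]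
        have : (l.length : ℝ) ≤ Fintype.card V := by exact_mod_cast hc
        nlinarith
      · have hsplit : ∃ i j : ℕ, ∃ (hj : j < l.length) (hij : i < j),
            D.src l[i] = D.src l[j] := by
          obtain ⟨i, j, hij, he⟩ := Fintype.exists_ne_map_eq_of_card_lt
            (fun i : Fin l.length => D.src l[i]) (by simpa using hc)
          rcases lt_or_gt_of_ne hij with h | h
          · exact ⟨i, j, j.2, h, he⟩
          · exact ⟨j, i, i.2, h, he.symm⟩
        obtain ⟨i, j, hj, hij, he⟩ := hsplit
        obtain ⟨_, u, hw⟩ := cw_iff.1 h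
        obtain ⟨w1, w2⟩ := wk_split hw j hj
        have hjl : (l.take j).length = j := by simp; omega
        obtain ⟨w3, w4⟩ := wk_split w1 i (by omega)
        rw [List.getElem_take, he] at w3 w4
        have hx : D.IsCycleWord ((l.take j).drop i) := by
          refine cw_iff.2 ⟨?_, _, w4⟩
          intro h0
          have := congrArg List.length h0
          simp only [List.length_drop, hjl, List.length_nil] at this
          omega
        have hy : D.IsCycleWord ((l.take j).take i ++ l.drop j) := by
          refine cw_iff.2 ⟨?_, u, wk_append.2 ⟨_, w3, w2⟩⟩
          intro h0
          have := congrArg List.length h0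
          simp at this
          omega
        have e : l = (l.take j).take i ++ (l.take j).drop i ++ l.drop j := by simp
        have hlen := congrArg List.length e
        simp only [List.length_append] at hlen
        have hx0 := List.length_pos_iff.2 hx.1
        have hy0 := List.length_pos_iff.2 hy.1
        simp only [List.length_append] at hy0
        have i1 := ih _ (by omega) hx
        have i2 := ih _ (by rw [List.length_append]; omega) hy
        have hs := congrArg (fun l => (List.map α l).sum) e
        simp only [List.map_append, List.sum_append] at hs i2
        rw [List.length_append] at i2
        push_cast at i2
        have hlen' : (l.length : ℝ) = ((l.take j).take i).length + ((l.take j).drop i).length + (l.drop j).length := by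
          exact_mod_cast hlen
        rw [hs, hlen']
        linarith
  exact fun l h => key _ l le_rfl h

/-- cycles of bounded weight -/
def SL (D : Multidigraph V E) (α : E → ℝ) (L : ℝ) : Set D.Cycle := {c | D.weight α c ≤ L}

theorem gr_eq (α : E → ℝ) : D.growthRate α =
    limsup (fun L : ℝ => ((SL D α L).ncard : ℝ) ^ (1 / L)) atTop := by
  unfold growthRate growthRateOn
  have : ∀ L : ℝ, { c : D.Cycle | D.CycleIn Set.univ c ∧ D.weight α c ≤ L } = SL D α L := by
    intro L
    ext c
    exact ⟨fun h => h.2, fun h => ⟨fun e _ => Set.mem_univ e, h⟩⟩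
  simp only [this]
  rfl

theorem SL_card [Fintype V] [Fintype E] (α : E → ℝ) (δ : ℝ) (hδ : 0 < δ)
    (h : ∀ l, D.IsCycleWord l → δ * l.length ≤ (l.map α).sum) (L : ℝ) :
    (SL D α L).Finite ∧ (SL D α L).ncard ≤ (Fintype.card E + 1) ^ ⌊L / δ⌋₊ := by
  classical
  choose w hw hcw using cls_surj (D := D)
  let g : D.Cycle → (Fin ⌊L / δ⌋₊ → Option E) := fun c i => (w c)[(i:ℕ)]?
  have hlen : ∀ c ∈ SL D α L, (w c).length ≤ ⌊L / δ⌋₊ := by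
    intro c hc
    apply Nat.le_floor
    rw [le_div_iff₀ hδ, mul_comm]
    refine (h _ (hw c)).trans ?_
    have : D.weight α c ≤ L := hc
    rw [hcw c] at this
    exact this
  have hinj : Set.InjOn g (SL D α L) := by
    intro c hc c' hc' e
    have : w c = w c' := by
      apply List.ext_getElem?
      intro i
      by_cases hi : i < ⌊L / δ⌋₊
      · exact congrFun e ⟨i, hi⟩
      · rw [List.getElem?_eq_none (by have := hlen c hc; omega),
          List.getElem?_eq_none (by have := hlen c' hc'; omega)]
    rw [hcw c, hcw c', cls_eq, this]
  refine ⟨Set.Finite.of_finite_image (Set.toFinite _) hinj, ?_⟩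
  rw [← Set.ncard_image_of_injOn hinj]
  refine (Set.ncard_le_ncard (Set.subset_univ _)).trans ?_
  rw [Set.ncard_univ]
  simp

theorem bdd [Fintype V] [Fintype E] (α : E → ℝ) (δ : ℝ) (hδ : 0 < δ)
    (h : ∀ l, D.IsCycleWord l → δ * l.length ≤ (l.map α).sum) :
    IsBoundedUnder (· ≤ ·) atTop (fun L : ℝ => ((SL D α L).ncard : ℝ) ^ (1 / L)) := by
  refine isBoundedUnder_of_eventually_le (a := ((Fintype.card E : ℝ) + 1) ^ (1 / δ)) ?_
  filter_upwards [eventually_gt_atTop 0] with L hL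
  have h1 : ((SL D α L).ncard : ℝ) ≤ ((Fintype.card E : ℝ) + 1) ^ (⌊L / δ⌋₊ : ℝ) := by
    rw [Real.rpow_natCast]
    exact_mod_cast (SL_card α δ hδ h L).2
  have hE : (1:ℝ) ≤ (Fintype.card E : ℝ) + 1 := by simp
  calc ((SL D α L).ncard : ℝ) ^ (1 / L) ≤ (((Fintype.card E : ℝ) + 1) ^ (⌊L / δ⌋₊ : ℝ)) ^ (1 / L) :=
        Real.rpow_le_rpow (by positivity) h1 (by positivity)
    _ ≤ (((Fintype.card E : ℝ) + 1) ^ (L / δ)) ^ (1 / L) := by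
        refine Real.rpow_le_rpow (by positivity) ?_ (by positivity)
        exact Real.rpow_le_rpow_of_exponent_le hE (Nat.floor_le (by positivity))
    _ = _ := by
        rw [← Real.rpow_mul (by positivity)]
        congr 1
        field_simp

theorem card_of_finite [Fintype V] [Fintype E] (α : E → ℝ) (δ : ℝ) (hδ : 0 < δ)
    (h : ∀ l, D.IsCycleWord l → δ * l.length ≤ (l.map α).sum)
    (hf : { c : D.Cycle | D.IsPrimitive c }.Finite) (L : ℝ) :
    (SL D α L).ncard ≤ { c : D.Cycle | D.IsPrimitive c }.ncard * (⌊L / δ⌋₊ + 1) := by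
  classical
  have H : ∀ c : D.Cycle, ∃ l p k, ∃ (hl : D.IsCycleWord l) (hp : D.IsCycleWord p),
      c = cls D l hl ∧ D.IsPrimitive (cls D p hp) ∧ k ≤ l.length ∧ l ~r lpow p k := by
    intro c
    obtain ⟨l, hl, e⟩ := cls_surj c
    obtain ⟨p, k, hp, h1, h2, h3⟩ := exists_root _ l hl le_rfl
    exact ⟨l, p, k, hl, hp, e, h1, h2, h3⟩
  choose l p k hl hp e h1 h2 h3 using H
  let g : D.Cycle → D.Cycle × ℕ := fun c => (cls D (p c) (hp c), k c)
  have hinj : Function.Injective g := by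
    intro c c' hc
    obtain ⟨a, b⟩ := Prod.mk.inj hc
    rw [e c, e c', cls_eq]
    have := cls_eq.1 a
    have h4 := lpow_rot this (k c)
    have h5 := (h3 c').symm
    rw [← b] at h5
    exact ((h3 c).trans h4).trans h5
  have hm : ∀ c ∈ SL D α L, g c ∈ hf.toFinset ×ˢ Finset.range (⌊L / δ⌋₊ + 1) := by
    intro c hc
    simp only [g, Finset.mem_product, Set.Finite.mem_toFinset, Set.mem_ofPred_eq, Finset.mem_range]
    refine ⟨h1 c, Nat.lt_succ_of_le ((h2 c).trans ?_)⟩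
    apply Nat.le_floor
    rw [le_div_iff₀ hδ, mul_comm]
    refine (h _ (hl c)).trans ?_
    have : D.weight α c ≤ L := hc
    rw [e c] at this
    exact this
  rw [← Set.ncard_image_of_injective _ hinj]
  refine (Set.ncard_le_ncard (t := ((hf.toFinset ×ˢ Finset.range (⌊L / δ⌋₊ + 1) : Finset _) : Set _)) ?_
    (Finset.finite_toSet _)).trans ?_
  · rintro _ ⟨c, hc, rfl⟩
    exact_mod_cast hm c hc
  · rw [Set.ncard_coe_finset, Finset.card_product, Finset.card_range, Set.ncard_eq_toFinset_card _ hf]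

theorem gr_le_of_finite [Fintype V] [Fintype E] (α : E → ℝ) (δ : ℝ) (hδ : 0 < δ)
    (h : ∀ l, D.IsCycleWord l → δ * l.length ≤ (l.map α).sum)
    (hf : { c : D.Cycle | D.IsPrimitive c }.Finite) : D.growthRate α ≤ 1 := by
  rw [gr_eq]
  have ht := tendsto_rpow_div_mul_add 2 1 0 one_ne_zero.symm
  refine le_trans (limsup_le_limsup ?_ ?_ ht.isBoundedUnder_le) ht.limsup_eq.le
  · set P := { c : D.Cycle | D.IsPrimitive c }.ncard
    filter_upwards [eventually_ge_atTop 1, eventually_ge_atTop (P / δ + P : ℝ)] with L h1 h2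
    have hc : ((SL D α L).ncard : ℝ) ≤ P * (L / δ + 1) := by
      have := card_of_finite α δ hδ h hf L
      calc ((SL D α L).ncard : ℝ) ≤ P * (⌊L / δ⌋₊ + 1) := by exact_mod_cast this
        _ ≤ _ := by
          gcongr
          exact Nat.floor_le (by positivity)
    have : ((SL D α L).ncard : ℝ) ≤ L ^ (2:ℝ) := by
      refine hc.trans ?_
      rw [Real.rpow_two]
      have hP : (0:ℝ) ≤ P := by positivity
      have : (P:ℝ) * (L / δ + 1) = P / δ * L + P := by ring
      rw [this]
      nlinarith
    calc _ ≤ (L ^ (2:ℝ)) ^ (1 / L) := Real.rpow_le_rpow (by positivity) this (by positivity)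
      _ = _ := by
        rw [← Real.rpow_mul (by positivity), one_mul, add_zero]
        congr 1
        ring
  · refine isCoboundedUnder_le_of_eventually_le (x := 0) _ ?_
    exact Eventually.of_forall (fun L => by positivity)

/-- block words -/
def blk (A B : List E) (s : List Bool) : List E := (s.map (fun b => if b then A else B)).flatten

theorem blk_cons (A B : List E) (b : Bool) (s : List Bool) :
    blk A B (b :: s) = (if b then A else B) ++ blk A B s := by simp [blk]

theorem blk_len {A B : List E} (hl : A.length = B.length) (s : List Bool) :
    (blk A B s).length = s.length * A.length := by
  induction s with
  | nil => simp [blk]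
  | cons b s ih =>
    rw [blk_cons, List.length_append, ih, List.length_cons]
    cases b <;> simp [hl] <;> ring

theorem blk_sum {A B : List E} (α : E → ℝ) (hl : (A.map α).sum = (B.map α).sum) (s : List Bool) :
    ((blk A B s).map α).sum = s.length * (A.map α).sum := by
  induction s with
  | nil => simp [blk]
  | cons b s ih =>
    rw [blk_cons, List.map_append, List.sum_append, ih, List.length_cons]
    cases b <;> simp [hl] <;> ring

theorem blk_wk {A B : List E} {v : V} (hA : Wk D v A v) (hB : Wk D v B v) (s : List Bool) :
    Wk D v (blk A B s) v := by
  induction s with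
  | nil => simp [blk, Wk]
  | cons b s ih =>
    rw [blk_cons, wk_append]
    refine ⟨v, ?_, ih⟩
    cases b <;> simp [hA, hB]

theorem blk_inj {A B : List E} (hl : A.length = B.length) (hne : A ≠ B) (s t : List Bool)
    (hst : s.length = t.length) (e : blk A B s = blk A B t) : s = t := by
  induction s generalizing t with
  | nil => exact (List.length_eq_zero_iff.1 hst.symm).symm
  | cons b s ih =>
    cases t with
    | nil => simp at hst
    | cons c t =>
      rw [blk_cons, blk_cons] at e
      obtain ⟨e1, e2⟩ := List.append_inj e (by cases b <;> cases c <;> simp [hl])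
      rw [ih t (by simpa using hst) e2]
      congr 1
      cases b <;> cases c <;> simp_all

theorem exp_count {A B : List E} {v : V} (hA : Wk D v A v) (hB : Wk D v B v)
    (hl : A.length = B.length) (hne : A ≠ B) (hA0 : A ≠ []) (α : E → ℝ)
    (hs : (A.map α).sum = (B.map α).sum) (n : ℕ) (hn : 0 < n)
    (hfin : (SL D α (n * (A.map α).sum)).Finite) :
    2 ^ n ≤ (n * A.length + 1) * (SL D α (n * (A.map α).sum)).ncard := by
  classical
  have hcw : ∀ s : Fin n → Bool, D.IsCycleWord (blk A B (List.ofFn s)) := by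
    intro s
    refine cw_iff.2 ⟨?_, v, blk_wk hA hB _⟩
    rw [← List.length_pos_iff, blk_len hl, List.length_ofFn]
    exact Nat.mul_pos hn (List.length_pos_iff.2 hA0)
  let F : (Fin n → Bool) → D.Cycle := fun s => cls D _ (hcw s)
  have hF : ∀ s ∈ (Finset.univ : Finset (Fin n → Bool)), F s ∈ hfin.toFinset := by
    intro s _
    simp only [Set.Finite.mem_toFinset, SL, Set.mem_ofPred_eq, F, weight_cls]
    rw [blk_sum α hs, List.length_ofFn]
  have := Finset.card_le_mul_card_image_of_maps_to hF (n * A.length + 1) ?_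
  · rw [Set.ncard_eq_toFinset_card _ hfin]
    simpa using this
  · intro c _
    by_cases hc : ∃ s, F s = c
    · obtain ⟨s0, rfl⟩ := hc
      set w0 := blk A B (List.ofFn s0) with hw0
      have hlen : w0.length = n * A.length := by rw [hw0, blk_len hl, List.length_ofFn]
      have h1 : (((List.range (w0.length + 1)).map w0.rotate).toFinset).card ≤ n * A.length + 1 := by
        refine (List.toFinset_card_le _).trans ?_
        simp [hlen]
      refine le_trans (Finset.card_le_card_of_injOn (fun s => blk A B (List.ofFn s)) ?_ ?_) h1
      · intro s hs'
        have hs2 : F s = F s0 := by simpa using hs'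
        have := (cls_eq.1 hs2).symm
        simpa using List.isRotated_iff_mem_map_range.1 this
      · intro s _ t _ e
        exact List.ofFn_injective (blk_inj hl hne _ _ (by simp) e)
    · push Not at hc
      rw [Finset.filter_false_of_mem (fun s _ => hc s)]
      simp

theorem exists_noncomm [Fintype V] (hi : { c : D.Cycle | D.IsPrimitive c }.Infinite) :
    ∃ v p q, Wk D v p v ∧ Wk D v q v ∧ p ++ q ≠ q ++ p := by
  have H : ∀ c : D.Cycle, ∃ l v, ∃ h : D.IsCycleWord l, c = cls D l h ∧ Wk D v l v := by
    intro c
    obtain ⟨l, h, e⟩ := cls_surj c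
    obtain ⟨_, v, hv⟩ := cw_iff.1 h
    exact ⟨l, v, h, e, hv⟩
  choose l v h e hw using H
  obtain ⟨c, hc, c', hc', hne, hv⟩ := hi.exists_ne_map_eq_of_mapsTo (f := v) (t := Set.univ)
    (fun _ _ => Set.mem_univ _) Set.finite_univ
  refine ⟨v c, l c, l c', hw c, hv ▸ hw c', ?_⟩
  intro hcomm
  obtain ⟨r, a, b, h1, h2⟩ := comm_pow _ _ _ le_rfl hcomm
  have hc1 : D.IsPrimitive (cls D (l c) (h c)) := by rw [← e c]; exact hc
  have hc2 : D.IsPrimitive (cls D (l c') (h c')) := by rw [← e c']; exact hc'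
  have ha := prim_word hc1 h1
  have hb := prim_word hc2 h2
  apply hne
  rw [e c, e c', cls_eq, h1, h2, ha, hb]

theorem gr_gt_of_infinite [Fintype V] [Fintype E] (α : E → ℝ) (δ : ℝ) (hδ : 0 < δ)
    (h : ∀ l, D.IsCycleWord l → δ * l.length ≤ (l.map α).sum)
    (hi : { c : D.Cycle | D.IsPrimitive c }.Infinite) : 1 < D.growthRate α := by
  obtain ⟨v, p, q, hp, hq, hne⟩ := exists_noncomm hi
  have hA : Wk D v (p ++ q) v := wk_append.2 ⟨v, hp, hq⟩
  have hB : Wk D v (q ++ p) v := wk_append.2 ⟨v, hq, hp⟩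
  have hl : (p ++ q).length = (q ++ p).length := by simp [add_comm]
  have hs : ((p ++ q).map α).sum = ((q ++ p).map α).sum := by simp [add_comm]
  have hA0 : p ++ q ≠ [] := by
    intro h0
    obtain ⟨rfl, rfl⟩ := List.append_eq_nil_iff.1 h0
    exact hne rfl
  generalize p ++ q = A at *
  generalize q ++ p = B at *
  have hw : 0 < (A.map α).sum := by
    have := h A (cw_iff.2 ⟨hA0, v, hA⟩)
    have h2 : (0:ℝ) < A.length := by exact_mod_cast List.length_pos_iff.2 hA0
    nlinarith [mul_pos hδ h2]
  set w := (A.map α).sum with hwdef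
  have hcount : ∀ n : ℕ, 0 < n → (2:ℝ) ^ n ≤ (n * A.length + 1) * (SL D α (n * w)).ncard := by
    intro n hn
    exact_mod_cast exp_count hA hB hl hne hA0 α hs n hn (SL_card α δ hδ h _).1
  rw [gr_eq]
  have hb : (1:ℝ) < (3/2 : ℝ) ^ (1 / w) := Real.one_lt_rpow (by norm_num) (by positivity)
  refine hb.trans_le (le_limsup_of_frequently_le ?_ (bdd α δ hδ h))
  have htop : Tendsto (fun n : ℕ => (n:ℝ) * w) atTop atTop :=
    Tendsto.atTop_mul_const hw tendsto_natCast_atTop_atTop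
  refine htop.frequently (Eventually.frequently ?_)
  have hlim : Tendsto (fun n : ℕ => (A.length + 1 : ℝ) * ((n:ℝ) ^ 1 * (3/4:ℝ) ^ n)) atTop (𝓝 ((A.length + 1 : ℝ) * 0)) :=
    (tendsto_pow_const_mul_const_pow_of_lt_one 1 (by norm_num) (by norm_num)).const_mul _
  rw [mul_zero] at hlim
  filter_upwards [hlim.eventually_lt_const one_pos, eventually_gt_atTop 0] with n h1 hn
  have hn1 : (1:ℝ) ≤ n := by exact_mod_cast hn
  have h2 : (3/2:ℝ) ^ n ≤ (SL D α (n * w)).ncard := by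
    have hk := hcount n hn
    have e2 : (2:ℝ) ^ n * (3/4) ^ n = (3/2) ^ n := by rw [← mul_pow]; norm_num
    have h3 : (n * A.length + 1 : ℝ) ≤ (A.length + 1) * n := by nlinarith
    set N : ℝ := ((SL D α (n * w)).ncard : ℝ)
    have hN : 0 ≤ N := by positivity
    calc (3/2:ℝ) ^ n = (2:ℝ) ^ n * (3/4) ^ n := e2.symm
      _ ≤ ((A.length + 1) * n * N) * (3/4) ^ n := by
        gcongr
        exact hk.trans (by gcongr)
      _ = ((A.length + 1 : ℝ) * ((n:ℝ) ^ 1 * (3/4:ℝ) ^ n)) * N := by ring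
      _ ≤ 1 * N := by gcongr
      _ = N := one_mul _
  calc (3/2 : ℝ) ^ (1 / w) = ((3/2:ℝ) ^ n) ^ (1 / (n * w)) := by
        rw [← Real.rpow_natCast, ← Real.rpow_mul (by norm_num)]
        congr 1
        field_simp
    _ ≤ _ := Real.rpow_le_rpow (by positivity) h2 (by positivity)

end GrAux

/-- Let `D` be a finite directed multigraph and `α` an edge weighting
positive on every directed cycle.  Then `gr_D(α) > 1` if and only if `D` has infinitely
many primitive directed cycles. -/
theorem growthRate_gt_one_iff_infinite_primitive_cycles
    {V E : Type} [Fintype V] [Fintype E] (D : Multidigraph V E)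
    (α : E → ℝ) (hα : ∀ c : D.Cycle, 0 < D.weight α c) :
    1 < D.growthRate α ↔ { c : D.Cycle | D.IsPrimitive c }.Infinite := by
  obtain ⟨δ, hδ, h⟩ := GrAux.exists_delta α hα
  constructor
  · intro h1 hf
    exact absurd (GrAux.gr_le_of_finite α δ hδ h hf) (not_le.2 h1)
  · exact GrAux.gr_gt_of_infinite α δ hδ h
end
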